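/- Let 1 ≤ α < 2 and let u₀ : [0,1] → ℝ be a continuous nonnegative function with 0 < ∫₀¹ u₀(x) dx < 1. Then there exists a nonnegative classical solution u of the one-dimensional nonlocal Fisher–KPP problem with initial datum u₀, and this solution is unique: any two nonnegative classical solutions with initial datum u₀ coincide on [0,∞) × [0,1]. -/

import Mathlib

open Set Real MeasureTheory intervalIntegral

/-- A (global) classical solution of the one-dimensional nonlocal Fisher–KPP problem
`∂ₜu = ∂ₓₓu + u^α (1 - ∫₀¹ u dy)` on `Ω = (0,1)`, with Neumann boundary conditions.
`ut`, `ux`, `uxx` are the time derivative and the first and second spatial derivatives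
of `u`; they exist on `(0,∞) × [0,1]` and are jointly continuous there, while `u`
itself is continuous on `[0,∞) × [0,1]`. -/
def IsKPPSolution (α : ℝ) (u ut ux uxx : ℝ → ℝ → ℝ) : Prop :=
  ContinuousOn (fun p : ℝ × ℝ => u p.1 p.2) (Ici 0 ×ˢ Icc 0 1) ∧
  ContinuousOn (fun p : ℝ × ℝ => ut p.1 p.2) (Ioi 0 ×ˢ Icc 0 1) ∧
  ContinuousOn (fun p : ℝ × ℝ => ux p.1 p.2) (Ioi 0 ×ˢ Icc 0 1) ∧
  ContinuousOn (fun p : ℝ × ℝ => uxx p.1 p.2) (Ioi 0 ×ˢ Icc 0 1) ∧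
  (∀ t ∈ Ioi (0:ℝ), ∀ x ∈ Icc (0:ℝ) 1, HasDerivAt (fun s => u s x) (ut t x) t) ∧
  (∀ t ∈ Ioi (0:ℝ), ∀ x ∈ Icc (0:ℝ) 1,
    HasDerivWithinAt (fun y => u t y) (ux t x) (Icc 0 1) x) ∧
  (∀ t ∈ Ioi (0:ℝ), ∀ x ∈ Icc (0:ℝ) 1,
    HasDerivWithinAt (fun y => ux t y) (uxx t x) (Icc 0 1) x) ∧
  (∀ t ∈ Ioi (0:ℝ), ∀ x ∈ Icc (0:ℝ) 1,
    ut t x = uxx t x + u t x ^ α * (1 - ∫ y in (0:ℝ)..1, u t y)) ∧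
  (∀ t ∈ Ioi (0:ℝ), ux t 0 = 0 ∧ ux t 1 = 0)

/-- Nonnegativity of a solution on `[0,∞) × [0,1]`. -/
def KPPNonneg (u : ℝ → ℝ → ℝ) : Prop :=
  ∀ t ∈ Ici (0:ℝ), ∀ x ∈ Icc (0:ℝ) 1, 0 ≤ u t x

namespace KPP
open Filter Topology ProbabilityTheory

/-- The standard Gaussian measure. -/
noncomputable abbrev gam : Measure ℝ := gaussianReal 0 1

/-- The heat semigroup on the line. -/
noncomputable def S (t : ℝ) (h : ℝ → ℝ) (x : ℝ) : ℝ := ∫ z, h (x + √(2 * t) * z) ∂gam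

/-- The first weighted heat average. -/
noncomputable def S1 (t : ℝ) (h : ℝ → ℝ) (x : ℝ) : ℝ := ∫ z, z * h (x + √(2 * t) * z) ∂gam

lemma integrable_id_gam : Integrable (fun z : ℝ => z) gam := by
  have := (memLp_id_gaussianReal (μ := 0) (v := 1) 1)
  exact memLp_one_iff_integrable.1 (by simpa using this : MemLp id 1 gam)

lemma integrable_abs_gam : Integrable (fun z : ℝ => |z|) gam := integrable_id_gam.abs

lemma integrable_sq_gam : Integrable (fun z : ℝ => z ^ 2) gam := by
  have := (memLp_id_gaussianReal (μ := 0) (v := 1) 2)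
  exact MemLp.integrable_sq (by simpa using this : MemLp id 2 gam)

/-- The first absolute moment. -/
noncomputable def m1 : ℝ := ∫ z, |z| ∂gam

lemma m1_nonneg : 0 ≤ m1 := integral_nonneg fun _ => abs_nonneg _

lemma integrable_gam_iff (f : ℝ → ℝ) :
    Integrable f gam ↔ Integrable (fun z => f z * gaussianPDFReal 0 1 z) := by
  rw [gam, gaussianReal_of_var_ne_zero 0 one_ne_zero,
    integrable_withDensity_iff_integrable_smul' (measurable_gaussianPDF _ _)
      (ae_of_all _ fun _ => gaussianPDF_lt_top)]
  simp [toReal_gaussianPDF, mul_comm]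

lemma integral_gam_eq (f : ℝ → ℝ) :
    ∫ z, f z ∂gam = ∫ z, f z * gaussianPDFReal 0 1 z := by
  rw [integral_gaussianReal_eq_integral_smul one_ne_zero]
  simp [mul_comm]

lemma hasDerivAt_pdf (z : ℝ) :
    HasDerivAt (gaussianPDFReal 0 1) (- (z * gaussianPDFReal 0 1 z)) z := by
  have h : gaussianPDFReal 0 1 = fun x : ℝ => (√(2 * π))⁻¹ * rexp (- x ^ 2 / 2) := by
    ext x; simp [gaussianPDFReal]
  rw [h]
  have := ((((hasDerivAt_id z).pow 2).neg.div_const 2).exp).const_mul ((√(2 * π))⁻¹)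
  refine this.congr_deriv ?_
  simp only [id_eq, Pi.pow_apply, Pi.neg_apply]
  ring

lemma stein {K K' : ℝ → ℝ} {C : ℝ} (hK : ∀ z, HasDerivAt K (K' z) z) (hK'c : Continuous K')
    (hb : ∀ z, |K' z| ≤ C) : ∫ z, z * K z ∂gam = ∫ z, K' z ∂gam := by
  have hKc : Continuous K := continuous_iff_continuousAt.2 fun z => (hK z).continuousAt
  have hlin : ∀ z, |K z| ≤ |K 0| + C * |z| := by
    intro z
    have := Convex.norm_image_sub_le_of_norm_hasDerivWithin_le (f := K) (f' := K') (C := C)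
      (s := univ) (x := 0) (y := z) (fun x _ => (hK x).hasDerivWithinAt)
      (fun x _ => by simpa using hb x) convex_univ (mem_univ _) (mem_univ _)
    simp only [Real.norm_eq_abs, sub_zero] at this
    have h2 := abs_sub_abs_le_abs_sub (K z) (K 0)
    linarith
  have i1 : Integrable K gam := by
    refine Integrable.mono' ((integrable_const (|K 0|)).add (integrable_abs_gam.const_mul C))
      hKc.aestronglyMeasurable (ae_of_all _ fun z => ?_)
    simpa using hlin z
  have i2 : Integrable (fun z => z * K z) gam := by
    refine Integrable.mono' ((integrable_abs_gam.const_mul (|K 0|)).add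
      (integrable_sq_gam.const_mul C))
      (by fun_prop) (ae_of_all _ fun z => ?_)
    simp only [Pi.add_apply, norm_mul, Real.norm_eq_abs]
    have := mul_le_mul_of_nonneg_left (hlin z) (abs_nonneg z)
    have h2 : |z| * |z| = z ^ 2 := by rw [abs_mul_abs_self]; ring
    calc |z| * |K z| ≤ |z| * (|K 0| + C * |z|) := this
      _ = |K 0| * |z| + C * (|z| * |z|) := by ring
      _ = _ := by rw [h2]
  have i3 : Integrable K' gam := by
    refine Integrable.mono' (integrable_const C)
      hK'c.aestronglyMeasurable (ae_of_all _ fun z => ?_)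
    simpa using hb z
  rw [integral_gam_eq, integral_gam_eq]
  rw [integrable_gam_iff] at i1 i2 i3
  have := MeasureTheory.integral_mul_deriv_eq_deriv_mul_of_integrable (u := K) (u' := K')
    (v := gaussianPDFReal 0 1) (v' := fun z => - (z * gaussianPDFReal 0 1 z)) (fun z _ => hK z)
    (fun z _ => hasDerivAt_pdf z)
    (by refine i2.neg.congr (ae_of_all _ fun z => ?_); simp; ring) i3 i1
  have h3 : ∫ z, z * K z * gaussianPDFReal 0 1 z =
      - ∫ z, K z * - (z * gaussianPDFReal 0 1 z) := by
    rw [← MeasureTheory.integral_neg]; congr 1; ext z; ring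
  rw [h3, this, neg_neg]

lemma swap_gam {F : ℝ → ℝ → ℝ} {B : ℝ} (hF : Continuous fun p : ℝ × ℝ => F p.1 p.2)
    (hb : ∀ y z, |F y z| ≤ B * (1 + |z|)) (a b : ℝ) :
    ∫ z, (∫ y in a..b, F y z) ∂gam = ∫ y in a..b, (∫ z, F y z ∂gam) := by
  have hi : ∀ a b : ℝ, Integrable (Function.uncurry fun z y => F y z)
      (gam.prod (volume.restrict (Ioc a b))) := by
    intro a b
    have hB : Integrable (fun p : ℝ × ℝ => B * (1 + |p.1|))
        (gam.prod (volume.restrict (Ioc a b))) :=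
      ((((integrable_const (1:ℝ)).add integrable_abs_gam).const_mul B).comp_fst _)
    refine hB.mono' ?_ (ae_of_all _ fun p => hb _ _)
    exact (hF.comp (continuous_snd.prodMk continuous_fst)).aestronglyMeasurable
  simp only [intervalIntegral]
  rw [MeasureTheory.integral_sub, MeasureTheory.integral_integral_swap (hi a b),
    MeasureTheory.integral_integral_swap (hi b a)]
  · exact (hi a b).integral_prod_left
  · exact (hi b a).integral_prod_left

section basic
variable {h : ℝ → ℝ} {C : ℝ}

lemma S_integrable (hc : Continuous h) (hb : ∀ x, |h x| ≤ C) (t x : ℝ) :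
    Integrable (fun z => h (x + √(2 * t) * z)) gam :=
  Integrable.mono' (integrable_const C) (by fun_prop) (ae_of_all _ fun z => by simpa using hb _)

lemma S1_integrable (hc : Continuous h) (hb : ∀ x, |h x| ≤ C) (t x : ℝ) :
    Integrable (fun z => z * h (x + √(2 * t) * z)) gam := by
  refine Integrable.mono' (integrable_abs_gam.mul_const C) (by fun_prop)
    (ae_of_all _ fun z => ?_)
  simp only [norm_mul, Real.norm_eq_abs]
  exact mul_le_mul_of_nonneg_left (hb _) (abs_nonneg _)

lemma S_bound (hb : ∀ x, |h x| ≤ C) (t x : ℝ) : |S t h x| ≤ C := by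
  have := norm_integral_le_of_norm_le_const (μ := gam) (f := fun z => h (x + √(2 * t) * z))
    (C := C) (ae_of_all _ fun z => by simpa using hb _)
  simpa [S] using this

lemma S1_bound (hb : ∀ x, |h x| ≤ C) (t x : ℝ) : |S1 t h x| ≤ m1 * C := by
  have := norm_integral_le_of_norm_le (μ := gam) (f := fun z => z * h (x + √(2 * t) * z))
    (integrable_abs_gam.mul_const C) (ae_of_all _ fun z => by
      simp only [norm_mul, Real.norm_eq_abs]
      exact mul_le_mul_of_nonneg_left (hb _) (abs_nonneg _))
  rwa [MeasureTheory.integral_mul_const] at this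

lemma S_nonneg (hp : ∀ x, 0 ≤ h x) (t x : ℝ) : 0 ≤ S t h x := integral_nonneg fun _ => hp _

lemma S_sub {h₁ h₂ : ℝ → ℝ} {C₁ C₂ : ℝ} (hc₁ : Continuous h₁) (hb₁ : ∀ x, |h₁ x| ≤ C₁)
    (hc₂ : Continuous h₂) (hb₂ : ∀ x, |h₂ x| ≤ C₂) (t x : ℝ) :
    S t h₁ x - S t h₂ x = S t (fun y => h₁ y - h₂ y) x := by
  unfold S
  rw [← MeasureTheory.integral_sub (S_integrable hc₁ hb₁ t x) (S_integrable hc₂ hb₂ t x)]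

@[simp] lemma S_zero (h : ℝ → ℝ) (x : ℝ) : S 0 h x = h x := by simp [S]

end basic

/-- joint continuity -/
lemma S_cont {f : ℝ → ℝ → ℝ} {C : ℝ} (hc : Continuous fun p : ℝ × ℝ => f p.1 p.2)
    (hb : ∀ s x, |f s x| ≤ C) :
    Continuous fun p : ℝ × ℝ × ℝ => S p.1 (f p.2.1) p.2.2 := by
  have hc' : ∀ {X : Type} [TopologicalSpace X] (a b : X → ℝ), Continuous a → Continuous b →
      Continuous fun x => f (a x) (b x) := fun a b ha hb => hc.comp (ha.prodMk hb)
  refine MeasureTheory.continuous_of_dominated (bound := fun _ => C) ?_ ?_ (integrable_const C) ?_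
  · intro p
    exact (hc' _ _ (by fun_prop) (by fun_prop)).aestronglyMeasurable
  · intro p; exact ae_of_all _ fun z => by simpa using hb _ _
  · refine ae_of_all _ fun z => hc' _ _ (by fun_prop) (by fun_prop)

lemma S1_cont {f : ℝ → ℝ → ℝ} {C : ℝ} (hc : Continuous fun p : ℝ × ℝ => f p.1 p.2)
    (hb : ∀ s x, |f s x| ≤ C) :
    Continuous fun p : ℝ × ℝ × ℝ => S1 p.1 (f p.2.1) p.2.2 := by
  have hc' : ∀ {X : Type} [TopologicalSpace X] (a b : X → ℝ), Continuous a → Continuous b →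
      Continuous fun x => f (a x) (b x) := fun a b ha hb => hc.comp (ha.prodMk hb)
  refine MeasureTheory.continuous_of_dominated (bound := fun z => |z| * C) ?_ ?_
    (integrable_abs_gam.mul_const C) ?_
  · intro p
    exact (continuous_id.mul (hc' _ _ (by fun_prop) (by fun_prop))).aestronglyMeasurable
  · intro p
    exact ae_of_all _ fun z => by
      simp only [norm_mul, Real.norm_eq_abs]
      exact mul_le_mul_of_nonneg_left (hb _ _) (abs_nonneg _)
  · refine ae_of_all _ fun z => continuous_const.mul (hc' _ _ (by fun_prop) (by fun_prop))

section one
variable {h : ℝ → ℝ} {C : ℝ}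

lemma S_cont1 (hc : Continuous h) (hb : ∀ x, |h x| ≤ C) :
    Continuous fun p : ℝ × ℝ => S p.1 h p.2 :=
  (S_cont (f := fun _ => h) (by fun_prop) (fun _ => hb)).comp
    (continuous_fst.prodMk (continuous_const.prodMk continuous_snd) :
      Continuous fun p : ℝ × ℝ => (p.1, (0:ℝ), p.2))

lemma S1_cont1 (hc : Continuous h) (hb : ∀ x, |h x| ≤ C) :
    Continuous fun p : ℝ × ℝ => S1 p.1 h p.2 :=
  (S1_cont (f := fun _ => h) (by fun_prop) (fun _ => hb)).comp
    (continuous_fst.prodMk (continuous_const.prodMk continuous_snd) :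
      Continuous fun p : ℝ × ℝ => (p.1, (0:ℝ), p.2))

/-- smoothing: `S t h` is differentiable. -/
lemma S_hasDerivAt (hc : Continuous h) (hb : ∀ x, |h x| ≤ C) {t : ℝ} (ht : 0 < t) (x : ℝ) :
    HasDerivAt (S t h) (S1 t h x / √(2 * t)) x := by
  set σ := √(2 * t) with hσ
  have hσ0 : 0 < σ := Real.sqrt_pos.2 (by positivity)
  have hS1c : Continuous fun x => S1 t h x / σ :=
    ((S1_cont1 hc hb).comp (continuous_const.prodMk continuous_id)).div_const _
  have hH : ∀ y, HasDerivAt (fun y => ∫ r in (0:ℝ)..y, h r) (h y) y := fun y =>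
    intervalIntegral.integral_hasDerivAt_right (hc.intervalIntegrable _ _)
      (hc.stronglyMeasurableAtFilter _ _) hc.continuousAt
  have key : ∀ b, S t h b = S t h 0 + ∫ y in (0:ℝ)..b, S1 t h y / σ := by
    intro b
    -- apply stein
    have hst := stein (K := fun z => (∫ r in (0:ℝ)..(b + σ * z), h r) - ∫ r in (0:ℝ)..(0 + σ * z), h r)
      (K' := fun z => (h (b + σ * z) - h (0 + σ * z)) * σ) (C := (C + C) * σ)
      (fun z => by
        have e1 := (hH (b + σ * z)).comp z (((hasDerivAt_id z).const_mul σ).const_add b)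
        have e2 := (hH (0 + σ * z)).comp z (((hasDerivAt_id z).const_mul σ).const_add 0)
        have := e1.sub e2
        refine this.congr_deriv ?_
        ring) (by fun_prop) (fun z => by
          rw [abs_mul, abs_of_pos hσ0]
          refine mul_le_mul_of_nonneg_right ?_ hσ0.le
          exact (abs_sub _ _).trans (add_le_add (hb _) (hb _)))
    have e1 : ∀ z, (∫ r in (0:ℝ)..(b + σ * z), h r) - ∫ r in (0:ℝ)..(0 + σ * z), h r =
        ∫ y in (0:ℝ)..b, h (y + σ * z) := by
      intro z
      rw [intervalIntegral.integral_interval_sub_left (hc.intervalIntegrable _ _)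
        (hc.intervalIntegrable _ _), intervalIntegral.integral_comp_add_right]
    simp only [e1] at hst
    have e2 : ∫ z, (z * ∫ y in (0:ℝ)..b, h (y + σ * z)) ∂gam = ∫ y in (0:ℝ)..b, S1 t h y := by
      simp only [← intervalIntegral.integral_const_mul]
      unfold S1
      have hC : 0 ≤ C := (abs_nonneg _).trans (hb 0)
      refine swap_gam (F := fun y z => z * h (y + σ * z)) (B := C) (by fun_prop) ?_ 0 b
      intro y z
      rw [abs_mul]
      nlinarith [hb (y + σ * z), abs_nonneg z]
    have e3 : ∫ z, (h (b + σ * z) - h (0 + σ * z)) * σ ∂gam = (S t h b - S t h 0) * σ := by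
      rw [MeasureTheory.integral_mul_const, MeasureTheory.integral_sub (S_integrable hc hb t b) (S_integrable hc hb t 0)]
      rfl
    rw [e2, e3] at hst
    rw [intervalIntegral.integral_div, hst]
    field_simp
    ring
  have : S t h = fun b => S t h 0 + ∫ y in (0:ℝ)..b, S1 t h y / σ := funext key
  rw [this]
  exact (intervalIntegral.integral_hasDerivAt_right (hS1c.intervalIntegrable _ _)
      (hS1c.stronglyMeasurableAtFilter _ _) hS1c.continuousAt).const_add _

end one
end KPP

namespace KPP
open Filter Topology ProbabilityTheory

lemma S_eq_gaussian {h : ℝ → ℝ} (hc : Continuous h) {t : ℝ} (ht : 0 ≤ t) (x : ℝ) :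
    S t h x = ∫ y, h (x + y) ∂(gaussianReal 0 ((2 * t).toNNReal)) := by
  have := gaussianReal_map_const_mul (μ := 0) (v := 1) (√(2 * t))
  have e : (NNReal.mk (√(2 * t) ^ 2) (sq_nonneg _) * 1 : NNReal) = (2 * t).toNNReal := by
    ext
    rw [Real.coe_toNNReal _ (by positivity)]
    rw [mul_one]
    exact Real.sq_sqrt (by positivity : (0:ℝ) ≤ 2 * t)
  rw [e, mul_zero] at this
  rw [← this, integral_map (by fun_prop) (by fun_prop)]
  rfl

lemma S_semigroup {h : ℝ → ℝ} {C : ℝ} (hc : Continuous h) (hb : ∀ x, |h x| ≤ C) {t s : ℝ}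
    (ht : 0 ≤ t) (hs : 0 ≤ s) (x : ℝ) : S t (S s h) x = S (t + s) h x := by
  have hSc : Continuous (S s h) :=
    (S_cont1 hc hb).comp (continuous_const.prodMk continuous_id)
  have e : (2 * (t + s)).toNNReal = (2 * t).toNNReal + (2 * s).toNNReal := by
    rw [← Real.toNNReal_add (by positivity) (by positivity)]; congr 1; ring
  rw [S_eq_gaussian hSc ht, S_eq_gaussian hc (add_nonneg ht hs), e, ← add_zero (0:ℝ),
    ← gaussianReal_conv_gaussianReal, integral_conv]
  · simp only [add_zero]
    congr 1; ext y
    rw [S_eq_gaussian hc hs]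
    simp only [add_assoc]
  · exact Integrable.mono' (integrable_const C) (by fun_prop) (ae_of_all _ fun z => by simpa using hb _)

lemma S_deriv_comm {h h' : ℝ → ℝ} {C C' : ℝ} (hb : ∀ x, |h x| ≤ C)
    (hd : ∀ x, HasDerivAt h (h' x) x) (hc' : Continuous h') (hb' : ∀ x, |h' x| ≤ C') (t x : ℝ) :
    HasDerivAt (S t h) (S t h' x) x := by
  have hc : Continuous h := continuous_iff_continuousAt.2 fun z => (hd z).continuousAt
  refine (_root_.hasDerivAt_integral_of_dominated_loc_of_deriv_le (μ := gam) (s := univ)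
    (F := fun y z => h (y + √(2 * t) * z)) (F' := fun y z => h' (y + √(2 * t) * z))
    (bound := fun _ => C') univ_mem ?_ ?_ ?_ ?_ (integrable_const _) ?_).2
  · exact Eventually.of_forall fun y => by fun_prop
  · exact S_integrable hc hb t x
  · fun_prop
  · exact ae_of_all _ fun z y _ => by simpa using hb' _
  · exact ae_of_all _ fun z y _ => (hd _).comp_add_const y (√(2 * t) * z)

/-- Duhamel integral. -/
noncomputable def D (f : ℝ → ℝ → ℝ) (t x : ℝ) : ℝ :=
  t * ∫ σ in (0:ℝ)..1, S (t * (1 - σ)) (f (t * σ)) x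

/-- space derivative of the Duhamel integral. -/
noncomputable def E (f : ℝ → ℝ → ℝ) (t x : ℝ) : ℝ :=
  √(t / 2) * ∫ σ in (0:ℝ)..1, (√(1 - σ))⁻¹ * S1 (t * (1 - σ)) (f (t * σ)) x

lemma D_eq (f : ℝ → ℝ → ℝ) (t x : ℝ) : D f t x = ∫ s in (0:ℝ)..t, S (t - s) (f s) x := by
  have := intervalIntegral.smul_integral_comp_mul_left (a := 0) (b := 1)
    (fun s => S (t - s) (f s) x) t
  simp only [mul_zero, mul_one, smul_eq_mul] at this
  rw [← this, D]
  congr 2; ext σ; congr 1; ring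

section D
variable {f : ℝ → ℝ → ℝ} {C : ℝ}

lemma S_cont_comp (hc : Continuous fun p : ℝ × ℝ => f p.1 p.2)
    (hb : ∀ s x, |f s x| ≤ C) {X : Type*} [TopologicalSpace X] {a b c : X → ℝ}
    (ha : Continuous a) (hb' : Continuous b) (hc' : Continuous c) :
    Continuous fun p => S (a p) (f (b p)) (c p) :=
  (S_cont hc hb).comp (ha.prodMk (hb'.prodMk hc'))

lemma S1_cont_comp (hc : Continuous fun p : ℝ × ℝ => f p.1 p.2)
    (hb : ∀ s x, |f s x| ≤ C) {X : Type*} [TopologicalSpace X] {a b c : X → ℝ}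
    (ha : Continuous a) (hb' : Continuous b) (hc' : Continuous c) :
    Continuous fun p => S1 (a p) (f (b p)) (c p) :=
  (S1_cont hc hb).comp (ha.prodMk (hb'.prodMk hc'))

lemma D_cont (hc : Continuous fun p : ℝ × ℝ => f p.1 p.2) (hb : ∀ s x, |f s x| ≤ C) :
    Continuous fun p : ℝ × ℝ => D f p.1 p.2 := by
  unfold D
  refine continuous_fst.mul (intervalIntegral.continuous_parametric_intervalIntegral_of_continuous'
    (f := fun (p : ℝ × ℝ) σ => S (p.1 * (1 - σ)) (f (p.1 * σ)) p.2) ?_ 0 1)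
  exact S_cont_comp hc hb (by fun_prop) (by fun_prop) (by fun_prop)

lemma D_bound (hb : ∀ s x, |f s x| ≤ C) {t : ℝ} (ht : 0 ≤ t) (x : ℝ) : |D f t x| ≤ t * C := by
  rw [D, abs_mul, abs_of_nonneg ht]
  refine mul_le_mul_of_nonneg_left ?_ ht
  have := intervalIntegral.norm_integral_le_of_norm_le_const (a := 0) (b := 1) (C := C)
    (f := fun σ => S (t * (1 - σ)) (f (t * σ)) x) (fun σ _ => S_bound (hb _) _ _)
  simpa using this

lemma D_nonneg (hp : ∀ s x, 0 ≤ f s x) {t : ℝ} (ht : 0 ≤ t) (x : ℝ) : 0 ≤ D f t x :=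
  mul_nonneg ht (intervalIntegral.integral_nonneg zero_le_one fun _ _ => S_nonneg (hp _) _ _)

lemma inv_sqrt_integrable : IntervalIntegrable (fun σ : ℝ => (√(1 - σ))⁻¹) volume 0 1 := by
  have h := (intervalIntegral.intervalIntegrable_rpow' (a := 0) (b := 1) (r := -(1/2))
    (by norm_num)).comp_sub_left 1
  simp only [sub_zero, sub_self] at h
  refine h.symm.congr ?_
  intro σ hσ
  simp only [uIoc_of_le zero_le_one, mem_Ioc] at hσ
  simp only
  rw [Real.rpow_neg (by linarith), Real.sqrt_eq_rpow]

lemma inv_sqrt_meas : Measurable (fun σ : ℝ => (√(1 - σ))⁻¹) := by fun_prop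

/-- constant in the bound for `E` -/
noncomputable def cE : ℝ := ∫ σ in (0:ℝ)..1, (√(1 - σ))⁻¹ * m1

lemma E_bound (hb : ∀ s x, |f s x| ≤ C) (t x : ℝ) : |E f t x| ≤ √(t / 2) * (cE * C) := by
  rw [E, abs_mul, abs_of_nonneg (Real.sqrt_nonneg _)]
  refine mul_le_mul_of_nonneg_left ?_ (Real.sqrt_nonneg _)
  rw [cE, ← intervalIntegral.integral_mul_const]
  refine intervalIntegral.norm_integral_le_of_norm_le (μ := volume) (a := (0:ℝ)) (b := 1)
    (f := fun σ => (√(1 - σ))⁻¹ * S1 (t * (1 - σ)) (f (t * σ)) x)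
    (g := fun σ => (√(1 - σ))⁻¹ * m1 * C) zero_le_one (ae_of_all _ fun σ _ => ?_) ?_
  · rw [norm_mul, Real.norm_of_nonneg (by positivity), mul_assoc]
    exact mul_le_mul_of_nonneg_left (S1_bound (hb _) _ _) (by positivity)
  · exact (inv_sqrt_integrable.mul_const m1).mul_const C

lemma E_cont (hc : Continuous fun p : ℝ × ℝ => f p.1 p.2) (hb : ∀ s x, |f s x| ≤ C) :
    Continuous fun p : ℝ × ℝ => E f p.1 p.2 := by
  unfold E
  refine (by fun_prop : Continuous fun p : ℝ × ℝ => √(p.1 / 2)).mul ?_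
  refine intervalIntegral.continuous_of_dominated_interval
    (bound := fun σ => (√(1 - σ))⁻¹ * (m1 * C)) ?_ ?_ (inv_sqrt_integrable.mul_const _) ?_
  · intro p
    refine (inv_sqrt_meas.aestronglyMeasurable).mul ?_
    exact (S1_cont_comp hc hb (by fun_prop) (by fun_prop) (by fun_prop)).aestronglyMeasurable
  · intro p
    refine ae_of_all _ fun σ _ => ?_
    rw [norm_mul, Real.norm_of_nonneg (by positivity)]
    exact mul_le_mul_of_nonneg_left (S1_bound (hb _) _ _) (by positivity)
  · refine ae_of_all _ fun σ _ => continuous_const.mul ?_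
    exact (S1_cont_comp hc hb (by fun_prop) (by fun_prop) (by fun_prop))

lemma cont_right (hc : Continuous fun p : ℝ × ℝ => f p.1 p.2) (s : ℝ) : Continuous (f s) :=
  hc.comp (continuous_const.prodMk continuous_id)

lemma D_hasDerivAt (hc : Continuous fun p : ℝ × ℝ => f p.1 p.2) (hb : ∀ s x, |f s x| ≤ C)
    {t : ℝ} (ht : 0 < t) (x : ℝ) : HasDerivAt (D f t) (E f t x) x := by
  have hE : E f t x = t * ∫ σ in (0:ℝ)..1,
      S1 (t * (1 - σ)) (f (t * σ)) x / √(2 * (t * (1 - σ))) := by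
    rw [E, ← intervalIntegral.integral_const_mul, ← intervalIntegral.integral_const_mul]
    refine intervalIntegral.integral_congr fun σ hσ => ?_
    simp only [uIcc_of_le zero_le_one, mem_Icc] at hσ
    have h1 : √(2 * (t * (1 - σ))) = √(2 * t) * √(1 - σ) := by
      rw [← Real.sqrt_mul (by positivity)]; congr 1; ring
    have h2 : √(t / 2) * √(2 * t) = t := by
      rw [← Real.sqrt_mul (by positivity)]
      rw [show t / 2 * (2 * t) = t ^ 2 by ring, Real.sqrt_sq ht.le]
    have h3 : 0 < √(2 * t) := Real.sqrt_pos.2 (by positivity)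
    simp only [h1]
    have h4 : √(t / 2) = t * (√(2 * t))⁻¹ := (eq_mul_inv_iff_mul_eq₀ h3.ne').2 h2
    rw [h4, div_eq_mul_inv _ (√(2 * t) * √(1 - σ)), mul_inv]; ring
  rw [hE]
  refine HasDerivAt.const_mul t ?_
  refine (intervalIntegral.hasDerivAt_integral_of_dominated_loc_of_deriv_le (μ := volume)
    (s := univ) (F := fun y σ => S (t * (1 - σ)) (f (t * σ)) y)
    (F' := fun y σ => S1 (t * (1 - σ)) (f (t * σ)) y / √(2 * (t * (1 - σ))))
    (bound := fun σ => (√(1 - σ))⁻¹ * ((√(2 * t))⁻¹ * (m1 * C))) univ_mem ?_ ?_ ?_ ?_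
    (inv_sqrt_integrable.mul_const _) ?_).2
  · refine Eventually.of_forall fun y => ?_
    exact (S_cont_comp hc hb (by fun_prop) (by fun_prop) (by fun_prop)).aestronglyMeasurable
  · exact (S_cont_comp hc hb (by fun_prop) (by fun_prop) (by fun_prop)).intervalIntegrable _ _
  · refine Measurable.aestronglyMeasurable ?_
    refine Measurable.div ?_ (by fun_prop)
    exact (S1_cont_comp hc hb (by fun_prop) (by fun_prop) (by fun_prop)).measurable
  · refine ae_of_all _ fun σ hσ y _ => ?_
    have h1 : √(2 * (t * (1 - σ))) = √(2 * t) * √(1 - σ) := by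
      rw [← Real.sqrt_mul (by positivity)]; congr 1; ring
    rw [h1, div_eq_mul_inv, mul_inv, norm_mul, Real.norm_of_nonneg (by positivity : 0 ≤ (√(2 * t))⁻¹ * (√(1 - σ))⁻¹)]
    calc _ ≤ (m1 * C) * ((√(2 * t))⁻¹ * (√(1 - σ))⁻¹) :=
          mul_le_mul_of_nonneg_right (S1_bound (hb _) _ _) (by positivity)
      _ = _ := by ring
  · have : ∀ᵐ σ : ℝ, σ ≠ 1 := by simp [ae_iff]
    filter_upwards [this] with σ hσ1 hσ y _
    simp only [uIoc_of_le zero_le_one, mem_Ioc] at hσ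
    have : σ < 1 := lt_of_le_of_ne hσ.2 hσ1
    exact S_hasDerivAt (cont_right hc _) (hb _) (mul_pos ht (by linarith)) y

lemma D_deriv_comm {g : ℝ → ℝ → ℝ} {C' : ℝ}
    (hc : Continuous fun p : ℝ × ℝ => f p.1 p.2) (hb : ∀ s x, |f s x| ≤ C)
    (hd : ∀ s x, HasDerivAt (f s) (g s x) x)
    (hc' : Continuous fun p : ℝ × ℝ => g p.1 p.2) (hb' : ∀ s x, |g s x| ≤ C') (t x : ℝ) :
    HasDerivAt (D f t) (D g t x) x := by
  refine HasDerivAt.const_mul t ?_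
  refine (intervalIntegral.hasDerivAt_integral_of_dominated_loc_of_deriv_le (μ := volume)
    (s := univ) (F := fun y σ => S (t * (1 - σ)) (f (t * σ)) y)
    (F' := fun y σ => S (t * (1 - σ)) (g (t * σ)) y)
    (bound := fun σ => C') univ_mem ?_ ?_ ?_ ?_
    (by simp) ?_).2
  · refine Eventually.of_forall fun y => ?_
    exact (S_cont_comp hc hb (by fun_prop) (by fun_prop) (by fun_prop)).aestronglyMeasurable
  · exact (S_cont_comp hc hb (by fun_prop) (by fun_prop) (by fun_prop)).intervalIntegrable _ _
  · exact (S_cont_comp hc' hb' (by fun_prop) (by fun_prop) (by fun_prop)).aestronglyMeasurable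
  · exact ae_of_all _ fun σ hσ y _ => S_bound (hb' _) _ _
  · exact ae_of_all _ fun σ hσ y _ => S_deriv_comm (hb _) (hd _) (cont_right hc' _) (hb' _) _ _

lemma D_restart (hc : Continuous fun p : ℝ × ℝ => f p.1 p.2) (hb : ∀ s x, |f s x| ≤ C)
    {t₀ t : ℝ} (ht₀ : 0 ≤ t₀) (ht : 0 ≤ t) (x : ℝ) :
    D f (t₀ + t) x = S t (D f t₀) x + D (fun s => f (t₀ + s)) t x := by
  have hcont : ∀ T, Continuous fun s => S (T - s) (f s) x := fun T =>
    S_cont_comp hc hb (by fun_prop) (by fun_prop) (by fun_prop)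
  have hC : 0 ≤ C := (abs_nonneg _).trans (hb 0 0)
  rw [D_eq, ← intervalIntegral.integral_add_adjacent_intervals
    ((hcont _).intervalIntegrable 0 t₀) ((hcont _).intervalIntegrable t₀ _)]
  congr 1
  · have : S t (D f t₀) x = ∫ z, (∫ s in (0:ℝ)..t₀, S (t₀ - s) (f s) (x + √(2 * t) * z)) ∂gam := by
      unfold S
      congr 1; ext z; rw [D_eq]; rfl
    rw [this, swap_gam (F := fun s z => S (t₀ - s) (f s) (x + √(2 * t) * z)) (B := C)
      (S_cont_comp hc hb (by fun_prop) (by fun_prop) (by fun_prop)) ?_]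
    · refine intervalIntegral.integral_congr fun s hs => ?_
      simp only [uIcc_of_le ht₀, mem_Icc] at hs
      have := S_semigroup (cont_right hc s) (hb s) ht (by linarith : 0 ≤ t₀ - s) x
      rw [show t₀ + t - s = t + (t₀ - s) by ring, ← this]
      rfl
    · intro y z
      have := S_bound (hb y) (t₀ - y) (x + √(2 * t) * z)
      nlinarith [abs_nonneg z]
  · rw [D_eq]
    have := intervalIntegral.integral_comp_add_left (a := 0) (b := t)
      (fun s => S (t₀ + t - s) (f s) x) t₀
    simp only [add_zero] at this
    rw [← this]
    congr 1; ext s; congr 1; ring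

end D

lemma S_expand {φ φ' φ'' : ℝ → ℝ} {C₁ C₂ : ℝ} {C : ℝ} (hb : ∀ x, |φ x| ≤ C)
    (hd : ∀ x, HasDerivAt φ (φ' x) x) (hd' : ∀ x, HasDerivAt φ' (φ'' x) x)
    (hb₁ : ∀ x, |φ' x| ≤ C₁) (hb₂ : ∀ x, |φ'' x| ≤ C₂) (hc : Continuous φ'') {h : ℝ}
    (hh : 0 ≤ h) (x : ℝ) :
    S h φ x - φ x = h * ∫ σ in (0:ℝ)..1, 2 * σ * S (h * σ ^ 2) φ'' x := by
  have hc0 : Continuous φ := continuous_iff_continuousAt.2 fun z => (hd z).continuousAt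
  have hc1 : Continuous φ' := continuous_iff_continuousAt.2 fun z => (hd' z).continuousAt
  set r := √(2 * h) with hr
  have hr0 : 0 ≤ r := Real.sqrt_nonneg _
  have hr2 : r ^ 2 = 2 * h := Real.sq_sqrt (by positivity)
  have hder : ∀ σ ∈ uIcc (0:ℝ) 1, HasDerivAt (fun σ => ∫ z, φ (x + r * σ * z) ∂gam)
      (h * (2 * σ * S (h * σ ^ 2) φ'' x)) σ := by
    intro σ hσ
    simp only [uIcc_of_le zero_le_one, mem_Icc] at hσ
    have h1 := (_root_.hasDerivAt_integral_of_dominated_loc_of_deriv_le (μ := gam) (s := univ)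
      (x₀ := σ)
      (F := fun σ z => φ (x + r * σ * z)) (F' := fun σ z => φ' (x + r * σ * z) * (r * z))
      (bound := fun z => C₁ * (r * |z|)) univ_mem
      (Eventually.of_forall fun y => by fun_prop)
      (Integrable.mono' (integrable_const C) (by fun_prop)
        (ae_of_all _ fun z => by simpa using hb _)) (by fun_prop)
      (ae_of_all _ fun z y _ => by
        rw [norm_mul, norm_mul, Real.norm_of_nonneg hr0]
        exact mul_le_mul_of_nonneg_right (hb₁ _) (by positivity))
      ((integrable_abs_gam.const_mul r).const_mul C₁)
      (ae_of_all _ fun z y _ => by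
        have := (hd (x + r * y * z)).comp y
          ((((hasDerivAt_id y).const_mul r).mul_const z).const_add x)
        refine this.congr_deriv ?_
        ring)).2
    refine h1.congr_deriv ?_
    have h2 := stein (K := fun z => φ' (x + r * σ * z) * r)
      (K' := fun z => φ'' (x + r * σ * z) * (r * σ) * r) (C := C₂ * (r * σ) * r)
      (fun z => by
        have := (hd' (x + r * σ * z)).comp z
          (((hasDerivAt_id z).const_mul (r * σ)).const_add x)
        refine (this.mul_const r).congr_deriv ?_
        ring) (by fun_prop) (fun z => by
          rw [abs_mul, abs_mul, abs_of_nonneg hr0, abs_of_nonneg (mul_nonneg hr0 hσ.1)]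
          exact mul_le_mul_of_nonneg_right (mul_le_mul_of_nonneg_right (hb₂ _)
            (mul_nonneg hr0 hσ.1)) hr0)
    have h3 : √(2 * (h * σ ^ 2)) = r * σ := by
      rw [← mul_assoc, Real.sqrt_mul (by positivity), Real.sqrt_sq hσ.1]
    calc ∫ z, φ' (x + r * σ * z) * (r * z) ∂gam = ∫ z, z * (φ' (x + r * σ * z) * r) ∂gam := by
          congr 1; ext z; ring
      _ = _ := h2
      _ = _ := by
          rw [MeasureTheory.integral_mul_const, MeasureTheory.integral_mul_const, S, h3]
          linear_combination (σ * ∫ z, φ'' (x + r * σ * z) ∂gam) * hr2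
  have hSc : Continuous fun σ : ℝ => S (h * σ ^ 2) φ'' x :=
    (S_cont1 hc hb₂).comp (by fun_prop : Continuous fun σ : ℝ => (h * σ ^ 2, x))
  have := intervalIntegral.integral_eq_sub_of_hasDerivAt hder
    (by apply Continuous.intervalIntegrable; fun_prop)
  rw [intervalIntegral.integral_const_mul] at this
  rw [this]
  simp [S, ← hr]

end KPP

namespace KPP
open Filter Topology ProbabilityTheory

lemma per_int {h : ℝ → ℝ} (hp : ∀ x, h (x + 2) = h x) (a : ℝ) :
    ∫ x in (-1:ℝ)..1, h (x + a) = ∫ x in (-1:ℝ)..1, h x := by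
  have hp' : Function.Periodic h 2 := hp
  have := hp'.intervalIntegral_add_eq (-1 + a) (-1)
  rw [intervalIntegral.integral_comp_add_right]
  convert this using 2 <;> ring

section
variable {h : ℝ → ℝ} {C : ℝ}

lemma S_mass (hc : Continuous h) (hb : ∀ x, |h x| ≤ C) (hp : ∀ x, h (x + 2) = h x) (t : ℝ) :
    ∫ x in (-1:ℝ)..1, S t h x = ∫ x in (-1:ℝ)..1, h x := by
  have hC : 0 ≤ C := (abs_nonneg _).trans (hb 0)
  unfold S
  rw [← swap_gam (F := fun x z => h (x + √(2 * t) * z)) (B := C) (by fun_prop)]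
  · simp only [per_int hp]
    simp
  · intro y z
    nlinarith [abs_nonneg z, hb (y + √(2 * t) * z)]

lemma S1_mass (hc : Continuous h) (hb : ∀ x, |h x| ≤ C) (hp : ∀ x, h (x + 2) = h x) (t : ℝ) :
    ∫ x in (-1:ℝ)..1, |S1 t h x| ≤ m1 * ∫ x in (-1:ℝ)..1, |h x| := by
  have hC : 0 ≤ C := (abs_nonneg _).trans (hb 0)
  have hb2 : ∀ y z : ℝ, |(|z| * |h (y + √(2 * t) * z)|)| ≤ C * (1 + |z|) := by
    intro y z
    rw [abs_mul, abs_abs, abs_abs]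
    nlinarith [abs_nonneg z, hb (y + √(2 * t) * z)]
  have h1 : ∫ x in (-1:ℝ)..1, (∫ z, |z| * |h (x + √(2 * t) * z)| ∂gam) =
      m1 * ∫ x in (-1:ℝ)..1, |h x| := by
    rw [← swap_gam (F := fun x z => |z| * |h (x + √(2 * t) * z)|) (B := C) (by fun_prop) hb2]
    simp only [intervalIntegral.integral_const_mul]
    have := per_int (h := fun x => |h x|) (fun x => by simp [hp])
    simp only [this, MeasureTheory.integral_mul_const]
    rfl
  rw [← h1]
  have hS1c : Continuous fun x => S1 t h x :=
    (S1_cont1 hc hb).comp (continuous_const.prodMk continuous_id)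
  have hS2c : Continuous fun x => ∫ z, |z| * |h (x + √(2 * t) * z)| ∂gam := by
    refine MeasureTheory.continuous_of_dominated (bound := fun z => |z| * C) (fun _ => by fun_prop)
      ?_ (integrable_abs_gam.mul_const C) (ae_of_all _ fun z => by fun_prop)
    intro p
    exact ae_of_all _ fun z => by
      simp only [norm_mul, Real.norm_eq_abs, abs_abs]
      exact mul_le_mul_of_nonneg_left (hb _) (abs_nonneg _)
  refine intervalIntegral.integral_mono_on (by norm_num) (hS1c.abs.intervalIntegrable _ _)
    (hS2c.intervalIntegrable _ _) fun x _ => ?_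
  refine MeasureTheory.abs_integral_le_integral_abs.trans (le_of_eq ?_)
  simp [abs_mul]

lemma S_sup (hc : Continuous h) (hb : ∀ x, |h x| ≤ C) (hp : ∀ x, h (x + 2) = h x)
    (h0 : ∀ x, 0 ≤ h x) {t : ℝ} (ht : 0 < t) {x : ℝ} (hx : x ∈ Icc (-1:ℝ) 1) :
    S t h x ≤ (1 / 2 + m1 / √(2 * t)) * ∫ x in (-1:ℝ)..1, h x := by
  have hS1c : Continuous fun x => S1 t h x / √(2 * t) :=
    ((S1_cont1 hc hb).comp (continuous_const.prodMk continuous_id)).div_const _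
  have hSc : Continuous fun x => S t h x :=
    ((S_cont1 hc hb).comp (continuous_const.prodMk continuous_id))
  have hσ : 0 < √(2 * t) := Real.sqrt_pos.2 (by positivity)
  set I := ∫ x in (-1:ℝ)..1, h x
  have h1 : ∫ y in (-1:ℝ)..1, |S1 t h y / √(2 * t)| ≤ m1 / √(2 * t) * I := by
    have := S1_mass hc hb hp t
    simp only [abs_of_nonneg (h0 _)] at this
    simp only [abs_div, abs_of_pos hσ]
    rw [intervalIntegral.integral_div, div_mul_eq_mul_div]
    gcongr
  have h2 : ∀ y ∈ Icc (-1:ℝ) 1, S t h x ≤ S t h y + m1 / √(2 * t) * I := by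
    intro y hy
    have e := intervalIntegral.integral_eq_sub_of_hasDerivAt (a := y) (b := x)
      (fun z _ => S_hasDerivAt hc hb ht z) (hS1c.intervalIntegrable _ _)
    have e2 : |∫ z in y..x, S1 t h z / √(2 * t)| ≤ ∫ y in (-1:ℝ)..1, |S1 t h y / √(2 * t)| := by
      have a1 := intervalIntegral.norm_integral_le_integral_norm_uIoc (a := y) (b := x)
        (f := fun z => S1 t h z / √(2 * t)) (μ := volume)
      refine a1.trans ?_
      rw [intervalIntegral.integral_of_le (by norm_num : (-1:ℝ) ≤ 1)]
      refine setIntegral_mono_set ?_ (ae_of_all _ fun _ => abs_nonneg _) ?_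
      · exact (hS1c.abs.intervalIntegrable (-1) 1).1
      · refine LE.le.eventuallyLE ?_
        intro z hz
        rw [uIoc, mem_Ioc] at hz
        exact ⟨lt_of_le_of_lt (le_min hy.1 hx.1) hz.1, hz.2.trans (max_le hy.2 hx.2)⟩
    have := le_abs_self (∫ z in y..x, S1 t h z / √(2 * t))
    linarith
  have h3 : ∫ y in (-1:ℝ)..1, S t h x ≤ ∫ y in (-1:ℝ)..1, (S t h y + m1 / √(2 * t) * I) :=
    intervalIntegral.integral_mono_on (by norm_num) (by simp)
      ((hSc.add continuous_const).intervalIntegrable _ _) h2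
  rw [intervalIntegral.integral_add (hSc.intervalIntegrable _ _) (by simp), S_mass hc hb hp] at h3
  simp only [intervalIntegral.integral_const, smul_eq_mul] at h3
  linarith

lemma gam_neg {g : ℝ → ℝ} (hg : Continuous g) : ∫ z, g (-z) ∂gam = ∫ z, g z ∂gam := by
  have := gaussianReal_map_neg (μ := 0) (v := 1)
  rw [neg_zero] at this
  conv_rhs => rw [gam, ← this]
  rw [integral_map (by fun_prop) (by fun_prop)]

lemma S_even (hc : Continuous h) (he : ∀ x, h (-x) = h x) (t x : ℝ) :
    S t h (-x) = S t h x := by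
  unfold S
  rw [← gam_neg (by fun_prop)]
  congr 1; ext z
  rw [← he]; congr 1; ring

lemma S_per (hp : ∀ x, h (x + 2) = h x) (t x : ℝ) : S t h (x + 2) = S t h x := by
  unfold S
  congr 1; ext z
  rw [← hp (x + √(2 * t) * z)]; congr 1; ring

end

lemma D_even {f : ℝ → ℝ → ℝ} (hc : Continuous fun p : ℝ × ℝ => f p.1 p.2)
    (he : ∀ s x, f s (-x) = f s x) (t x : ℝ) : D f t (-x) = D f t x := by
  unfold D
  simp only [S_even (cont_right hc _) (he _)]

lemma D_per {f : ℝ → ℝ → ℝ} (hp : ∀ s x, f s (x + 2) = f s x) (t x : ℝ) :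
    D f t (x + 2) = D f t x := by
  unfold D
  simp only [S_per (hp _)]

lemma D_congr {f g : ℝ → ℝ → ℝ} {t : ℝ} (ht : 0 ≤ t) (h : ∀ s ∈ Icc 0 t, f s = g s) (x : ℝ) :
    D f t x = D g t x := by
  rw [D_eq, D_eq]
  refine intervalIntegral.integral_congr fun s hs => ?_
  rw [uIcc_of_le ht] at hs
  simp only [h s hs]

/-- mass of the Duhamel term -/
lemma D_mass {f : ℝ → ℝ → ℝ} {C : ℝ} (hc : Continuous fun p : ℝ × ℝ => f p.1 p.2)
    (hb : ∀ s x, |f s x| ≤ C) (hp : ∀ s x, f s (x + 2) = f s x) (t : ℝ) :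
    ∫ x in (-1:ℝ)..1, D f t x = ∫ s in (0:ℝ)..t, ∫ x in (-1:ℝ)..1, f s x := by
  simp only [D_eq]
  rw [intervalIntegral_intervalIntegral_swap]
  · simp only [S_mass (cont_right hc _) (hb _) (hp _)]
  · have : Continuous (Function.uncurry fun x s => S (t - s) (f s) x) :=
      S_cont_comp hc hb (by fun_prop) (by fun_prop) (by fun_prop)
    refine (this.continuousOn.integrableOn_compact
      ((isCompact_uIcc (a := (-1:ℝ)) (b := 1)).prod (isCompact_uIcc (a := 0) (b := t)))).mono_set ?_
    exact prod_mono uIoc_subset_uIcc uIoc_subset_uIcc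

lemma right_deriv {φ ψ : ℝ → ℝ} (hφ : ContinuousOn φ (Ioi 0)) (hψ : ContinuousOn ψ (Ioi 0))
    (hd : ∀ t, 0 < t → HasDerivWithinAt φ (ψ t) (Ici t) t) {t : ℝ} (ht : 0 < t) :
    HasDerivAt φ (ψ t) t := by
  set a := t / 2 with ha
  have ha0 : 0 < a := by positivity
  set ψ' : ℝ → ℝ := fun s => ψ (max s a)
  have hψ'c : Continuous ψ' := by
    refine hψ.comp_continuous (by fun_prop) fun s => lt_of_lt_of_le ha0 (le_max_right _ _)
  have hΨ : ∀ s, HasDerivAt (fun s => ∫ r in a..s, ψ' r) (ψ' s) s := fun y =>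
    intervalIntegral.integral_hasDerivAt_right (hψ'c.intervalIntegrable _ _)
      (hψ'c.stronglyMeasurableAtFilter _ _) hψ'c.continuousAt
  have hconst := constant_of_has_deriv_right_zero (f := fun s => φ s - ∫ r in a..s, ψ' r)
    (a := a) (b := 2 * t) (by
      refine (hφ.mono fun s hs => lt_of_lt_of_le ha0 hs.1).sub ?_
      exact (continuous_iff_continuousAt.2 fun s => (hΨ s).continuousAt).continuousOn)
    (fun s hs => by
      have := (hd s (lt_of_lt_of_le ha0 hs.1)).sub (hΨ s).hasDerivWithinAt
      have e : ψ' s = ψ s := by simp [ψ', max_eq_left hs.1]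
      rw [e, sub_self] at this
      exact this)
  have hev : φ =ᶠ[𝓝 t] fun s => φ a + ∫ r in a..s, ψ' r := by
    filter_upwards [Ioo_mem_nhds (show a < t by rw [ha]; linarith) (show t < 2 * t by linarith)]
      with s hs
    have := hconst s ⟨hs.1.le, hs.2.le⟩
    simp at this
    linarith
  refine HasDerivAt.congr_of_eventuallyEq ?_ hev
  have e : ψ' t = ψ t := by simp [ψ', max_eq_left (show a ≤ t by rw [ha]; linarith)]
  rw [← e]
  exact (hΨ t).const_add _

end KPP

namespace KPP
open Filter Topology ProbabilityTheory

/-- space derivative of a mild solution -/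
noncomputable def W (h : ℝ → ℝ) (f : ℝ → ℝ → ℝ) (t x : ℝ) : ℝ :=
  S1 t h x / √(2 * t) + E f t x

section
variable {h : ℝ → ℝ} {f : ℝ → ℝ → ℝ} {C A : ℝ}

lemma W_hasDerivAt (hc : Continuous h) (hb : ∀ x, |h x| ≤ C)
    (fc : Continuous fun p : ℝ × ℝ => f p.1 p.2) (fb : ∀ s x, |f s x| ≤ A) {t : ℝ} (ht : 0 < t)
    (x : ℝ) : HasDerivAt (fun x => S t h x + D f t x) (W h f t x) x :=
  (S_hasDerivAt hc hb ht x).add (D_hasDerivAt fc fb ht x)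

lemma W_cont (hc : Continuous h) (hb : ∀ x, |h x| ≤ C)
    (fc : Continuous fun p : ℝ × ℝ => f p.1 p.2) (fb : ∀ s x, |f s x| ≤ A) :
    ContinuousOn (fun p : ℝ × ℝ => W h f p.1 p.2) (Ioi 0 ×ˢ univ) := by
  refine ContinuousOn.add (ContinuousOn.div (S1_cont1 hc hb).continuousOn
    (by fun_prop) ?_) (E_cont fc fb).continuousOn
  rintro ⟨t, x⟩ ⟨ht, -⟩
  have : (0:ℝ) < t := ht
  exact (Real.sqrt_pos.2 (by positivity)).ne'

lemma W_bound (hb : ∀ x, |h x| ≤ C) (fb : ∀ s x, |f s x| ≤ A) {t₀ T t : ℝ}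
    (ht₀ : 0 < t₀) (h1 : t₀ ≤ t) (h2 : t ≤ T) (x : ℝ) :
    |W h f t x| ≤ m1 * C / √(2 * t₀) + √(T / 2) * |cE * A| := by
  have hσ : 0 < √(2 * t₀) := Real.sqrt_pos.2 (by positivity)
  have hC : 0 ≤ C := (abs_nonneg _).trans (hb 0)
  have hm := m1_nonneg
  refine (abs_add_le _ _).trans (add_le_add ?_ ?_)
  · rw [abs_div, abs_of_nonneg (Real.sqrt_nonneg _)]
    gcongr
    exact S1_bound hb _ _
  · refine (E_bound fb t x).trans ?_
    refine (mul_le_mul_of_nonneg_left (le_abs_self (cE * A)) (Real.sqrt_nonneg _)).trans ?_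
    exact mul_le_mul_of_nonneg_right (Real.sqrt_le_sqrt (by linarith)) (abs_nonneg _)

end

/-- A bundled set of hypotheses on a nonnegative bounded mild solution. -/
structure MildSol (α : ℝ) (h : ℝ → ℝ) (u : ℝ → ℝ → ℝ) (θ : ℝ → ℝ) (K : ℝ) : Prop where
  ha : 1 ≤ α
  hc : Continuous h
  hb : ∀ x, |h x| ≤ K
  uc : Continuous fun p : ℝ × ℝ => u p.1 p.2
  u0 : ∀ t x, 0 ≤ u t x
  ub : ∀ t x, u t x ≤ K
  tc : Continuous θ
  t0 : ∀ t, 0 ≤ θ t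
  t1 : ∀ t, θ t ≤ 1
  mild : ∀ t, 0 ≤ t → ∀ x, u t x = S t h x + D (fun s x => u s x ^ α * θ s) t x

namespace MildSol
variable {α : ℝ} {h : ℝ → ℝ} {u : ℝ → ℝ → ℝ} {θ : ℝ → ℝ} {K : ℝ}

/-- the source term -/
noncomputable def src (α : ℝ) (u : ℝ → ℝ → ℝ) (θ : ℝ → ℝ) (s x : ℝ) : ℝ := u s x ^ α * θ s

lemma src_cont (H : MildSol α h u θ K) : Continuous fun p : ℝ × ℝ => src α u θ p.1 p.2 :=
  (H.uc.rpow_const fun _ => Or.inr (by linarith [H.ha])).mul (H.tc.comp continuous_fst)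

lemma src_bound (H : MildSol α h u θ K) (s x : ℝ) : |src α u θ s x| ≤ K ^ α := by
  have h1 : 0 ≤ u s x ^ α := Real.rpow_nonneg (H.u0 s x) _
  have h2 : u s x ^ α ≤ K ^ α := Real.rpow_le_rpow (H.u0 s x) (H.ub s x) (by linarith [H.ha])
  rw [src, abs_of_nonneg (mul_nonneg h1 (H.t0 s))]
  nlinarith [H.t0 s, H.t1 s]

/-- the space derivative -/
noncomputable def ux (α : ℝ) (h : ℝ → ℝ) (u : ℝ → ℝ → ℝ) (θ : ℝ → ℝ) : ℝ → ℝ → ℝ :=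
  W h (src α u θ)

lemma K0 (H : MildSol α h u θ K) : 0 ≤ K := (H.u0 0 0).trans (H.ub 0 0)

lemma uabs (H : MildSol α h u θ K) (t x : ℝ) : |u t x| ≤ K := by
  rw [abs_of_nonneg (H.u0 t x)]; exact H.ub t x

lemma ux_hasDerivAt (H : MildSol α h u θ K) {t : ℝ} (ht : 0 < t) (x : ℝ) :
    HasDerivAt (u t) (ux α h u θ t x) x := by
  have := W_hasDerivAt H.hc H.hb H.src_cont H.src_bound ht x
  have e : u t = fun x => S t h x + D (src α u θ) t x := funext fun x => H.mild t ht.le x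
  rw [e]; exact this

lemma ux_cont (H : MildSol α h u θ K) :
    ContinuousOn (fun p : ℝ × ℝ => ux α h u θ p.1 p.2) (Ioi 0 ×ˢ univ) :=
  W_cont H.hc H.hb H.src_cont H.src_bound

lemma ux_bound (H : MildSol α h u θ K) {t₀ T : ℝ} (ht₀ : 0 < t₀) :
    ∃ B, ∀ t, t₀ ≤ t → t ≤ T → ∀ x, |ux α h u θ t x| ≤ B :=
  ⟨_, fun _ h1 h2 x => W_bound H.hb H.src_bound ht₀ h1 h2 x⟩

lemma restart (H : MildSol α h u θ K) {t₀ t : ℝ} (ht₀ : 0 ≤ t₀) (ht : 0 ≤ t) (x : ℝ) :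
    u (t₀ + t) x = S t (u t₀) x + D (fun s => src α u θ (t₀ + s)) t x := by
  rw [H.mild _ (by positivity)]
  have e := D_restart H.src_cont H.src_bound ht₀ ht x
  change S (t₀ + t) h x + D (src α u θ) (t₀ + t) x = _
  rw [e]
  have e2 : S t (u t₀) x = S t (S t₀ h) x + S t (D (src α u θ) t₀) x := by
    have hSc : Continuous (S t₀ h) :=
      (S_cont1 H.hc H.hb).comp (continuous_const.prodMk continuous_id)
    have hDc : Continuous (D (src α u θ) t₀) :=
      (D_cont H.src_cont H.src_bound).comp (continuous_const.prodMk continuous_id)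
    have i1 := S_integrable hSc (fun x => S_bound H.hb t₀ x) t x
    have i2 := S_integrable hDc (fun x => D_bound H.src_bound ht₀ x) t x
    have : u t₀ = fun x => S t₀ h x + D (src α u θ) t₀ x := funext fun x => H.mild t₀ ht₀ x
    rw [this]
    exact MeasureTheory.integral_add i1 i2
  rw [e2, S_semigroup H.hc H.hb ht ht₀, add_comm t t₀]
  ring

/-- clamped time -/
noncomputable def clk (t₀ T s : ℝ) : ℝ := t₀ + max 0 (min s T)

lemma clk_cont (t₀ T : ℝ) : Continuous (clk t₀ T) := by unfold clk; fun_prop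
lemma clk_ge (t₀ T s : ℝ) : t₀ ≤ clk t₀ T s := by unfold clk; linarith [le_max_left 0 (min s T)]
lemma clk_le {T : ℝ} (hT : 0 ≤ T) (t₀ s : ℝ) : clk t₀ T s ≤ t₀ + T := by
  unfold clk; linarith [max_le hT (min_le_right s T)]
lemma clk_eq {T s : ℝ} (t₀ : ℝ) (h0 : 0 ≤ s) (h1 : s ≤ T) : clk t₀ T s = t₀ + s := by
  unfold clk; rw [min_eq_left h1, max_eq_right h0]

/-- derivative of the source -/
noncomputable def dsrc (α : ℝ) (h : ℝ → ℝ) (u : ℝ → ℝ → ℝ) (θ : ℝ → ℝ) (t₀ T s x : ℝ) : ℝ :=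
  ux α h u θ (clk t₀ T s) x * α * u (clk t₀ T s) x ^ (α - 1) * θ (clk t₀ T s)

lemma dsrc_hasDerivAt (H : MildSol α h u θ K) {t₀ T : ℝ} (ht₀ : 0 < t₀) (s x : ℝ) :
    HasDerivAt (fun x => src α u θ (clk t₀ T s) x) (dsrc α h u θ t₀ T s x) x :=
  ((H.ux_hasDerivAt (ht₀.trans_le (clk_ge t₀ T s)) x).rpow_const (Or.inr H.ha)).mul_const _

lemma dsrc_cont (H : MildSol α h u θ K) {t₀ T : ℝ} (ht₀ : 0 < t₀) :
    Continuous fun p : ℝ × ℝ => dsrc α h u θ t₀ T p.1 p.2 := by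
  have c1 : Continuous fun p : ℝ × ℝ => (clk t₀ T p.1, p.2) :=
    ((clk_cont t₀ T).comp continuous_fst).prodMk continuous_snd
  have c2 : Continuous fun p : ℝ × ℝ => ux α h u θ (clk t₀ T p.1) p.2 :=
    H.ux_cont.comp_continuous c1 fun p => ⟨ht₀.trans_le (clk_ge t₀ T _), mem_univ _⟩
  have c3 : Continuous fun p : ℝ × ℝ => u (clk t₀ T p.1) p.2 ^ (α - 1) :=
    (H.uc.comp c1).rpow_const fun _ => Or.inr (by linarith [H.ha])
  exact ((c2.mul continuous_const).mul c3).mul (H.tc.comp ((clk_cont t₀ T).comp continuous_fst))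

lemma dsrc_bound (H : MildSol α h u θ K) {t₀ T : ℝ} (ht₀ : 0 < t₀) (hT : 0 ≤ T) :
    ∃ B, ∀ s x, |dsrc α h u θ t₀ T s x| ≤ B := by
  obtain ⟨B, hB⟩ := H.ux_bound (T := t₀ + T) ht₀
  have ha := H.ha
  refine ⟨B * α * K ^ (α - 1) * 1, fun s x => ?_⟩
  have hu := H.u0 (clk t₀ T s) x
  have h1 : 0 ≤ u (clk t₀ T s) x ^ (α - 1) := Real.rpow_nonneg hu _
  have h2 : u (clk t₀ T s) x ^ (α - 1) ≤ K ^ (α - 1) :=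
    Real.rpow_le_rpow hu (H.ub _ x) (by linarith)
  have h3 := hB _ (clk_ge t₀ T s) (clk_le hT t₀ s) x
  have h4 : 0 ≤ B := (abs_nonneg _).trans h3
  have := H.t1 (clk t₀ T s)
  have := H.t0 (clk t₀ T s)
  rw [dsrc, abs_mul, abs_mul, abs_mul, abs_of_nonneg h1, abs_of_nonneg this,
    abs_of_nonneg (by linarith : 0 ≤ α)]
  have h5 : 0 ≤ K ^ (α - 1) := Real.rpow_nonneg H.K0 _
  gcongr

lemma ux_cont_right (H : MildSol α h u θ K) {t : ℝ} (ht : 0 < t) :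
    Continuous (ux α h u θ t) :=
  H.ux_cont.comp_continuous (continuous_const.prodMk continuous_id) fun _ => ⟨ht, mem_univ _⟩

lemma u_cont_right (H : MildSol α h u θ K) (t : ℝ) : Continuous (u t) :=
  H.uc.comp (continuous_const.prodMk continuous_id)

lemma ux_restart (H : MildSol α h u θ K) {t₀ T t : ℝ} (ht₀ : 0 < t₀) (ht : 0 ≤ t) (htT : t ≤ T)
    (x : ℝ) :
    ux α h u θ (t₀ + t) x = S t (ux α h u θ t₀) x + D (dsrc α h u θ t₀ T) t x := by
  obtain ⟨B, hB⟩ := H.dsrc_bound ht₀ (ht.trans htT)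
  obtain ⟨B', hB'⟩ := H.ux_bound (T := t₀) ht₀
  have e : u (t₀ + t) = fun x => S t (u t₀) x + D (fun s => src α u θ (clk t₀ T s)) t x := by
    ext x
    rw [H.restart ht₀.le ht]
    congr 1
    refine D_congr ht (fun s hs => ?_) x
    rw [clk_eq t₀ hs.1 (hs.2.trans htT)]
  have d1 := H.ux_hasDerivAt (by positivity : 0 < t₀ + t) x
  have d2 := S_deriv_comm (H.uabs t₀) (H.ux_hasDerivAt ht₀) (H.ux_cont_right ht₀)
    (hB' t₀ le_rfl le_rfl) t x
  have d3 := D_deriv_comm (f := fun s => src α u θ (clk t₀ T s)) (C := K ^ α)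
    (H.src_cont.comp (((clk_cont t₀ T).comp continuous_fst).prodMk continuous_snd))
    (fun s x => H.src_bound _ _) (H.dsrc_hasDerivAt ht₀) (H.dsrc_cont ht₀) hB t x
  rw [e] at d1
  exact d1.unique (d2.add d3)

/-- local formula for the second derivative -/
noncomputable def V (α : ℝ) (h : ℝ → ℝ) (u : ℝ → ℝ → ℝ) (θ : ℝ → ℝ) (t₀ T : ℝ) : ℝ → ℝ → ℝ :=
  W (ux α h u θ t₀) (dsrc α h u θ t₀ T)

lemma V_hasDerivAt (H : MildSol α h u θ K) {t₀ T t : ℝ} (ht₀ : 0 < t₀) (ht : 0 < t) (htT : t ≤ T)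
    (x : ℝ) : HasDerivAt (ux α h u θ (t₀ + t)) (V α h u θ t₀ T t x) x := by
  obtain ⟨B, hB⟩ := H.dsrc_bound ht₀ (ht.le.trans htT)
  obtain ⟨B', hB'⟩ := H.ux_bound (T := t₀) ht₀
  have := W_hasDerivAt (H.ux_cont_right ht₀) (hB' t₀ le_rfl le_rfl) (H.dsrc_cont (T := T) ht₀) hB ht x
  have e : ux α h u θ (t₀ + t) = fun x => S t (ux α h u θ t₀) x + D (dsrc α h u θ t₀ T) t x :=
    funext fun x => H.ux_restart ht₀ ht.le htT x
  rw [e]; exact this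

lemma V_cont (H : MildSol α h u θ K) {t₀ T : ℝ} (ht₀ : 0 < t₀) (hT : 0 ≤ T) :
    ContinuousOn (fun p : ℝ × ℝ => V α h u θ t₀ T p.1 p.2) (Ioi 0 ×ˢ univ) := by
  obtain ⟨B, hB⟩ := H.dsrc_bound ht₀ hT
  obtain ⟨B', hB'⟩ := H.ux_bound (T := t₀) ht₀
  exact W_cont (H.ux_cont_right ht₀) (hB' t₀ le_rfl le_rfl) (H.dsrc_cont (T := T) ht₀) hB

/-- second derivative -/
noncomputable def uxx (α : ℝ) (h : ℝ → ℝ) (u : ℝ → ℝ → ℝ) (θ : ℝ → ℝ) (t x : ℝ) : ℝ :=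
  deriv (ux α h u θ t) x

lemma uxx_eq (H : MildSol α h u θ K) {t₀ T t : ℝ} (ht₀ : 0 < t₀) (ht : t₀ < t) (htT : t ≤ t₀ + T)
    (x : ℝ) : uxx α h u θ t x = V α h u θ t₀ T (t - t₀) x := by
  have := (H.V_hasDerivAt ht₀ (by linarith : 0 < t - t₀) (by linarith : t - t₀ ≤ T) x).deriv
  rwa [add_sub_cancel] at this

lemma uxx_hasDerivAt (H : MildSol α h u θ K) {t : ℝ} (ht : 0 < t) (x : ℝ) :
    HasDerivAt (ux α h u θ t) (uxx α h u θ t x) x := by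
  have := (H.V_hasDerivAt (t₀ := t / 2) (T := t / 2) (t := t / 2)
    (by linarith) (by linarith) (by linarith) x)
  rw [add_halves] at this
  exact this.differentiableAt.hasDerivAt

lemma uxx_cont (H : MildSol α h u θ K) :
    ContinuousOn (fun p : ℝ × ℝ => uxx α h u θ p.1 p.2) (Ioi 0 ×ˢ univ) := by
  rintro ⟨t, x⟩ ⟨ht, -⟩
  have ht : (0:ℝ) < t := ht
  refine ContinuousAt.continuousWithinAt ?_
  have h1 : ContinuousAt (fun p : ℝ × ℝ => V α h u θ (t / 2) t (p.1 - t / 2) p.2) (t, x) := by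
    have h2 : ContinuousAt (fun p : ℝ × ℝ => V α h u θ (t / 2) t p.1 p.2) (t - t / 2, x) :=
      (H.V_cont (by positivity) ht.le).continuousAt
        (prod_mem_nhds (Ioi_mem_nhds (by linarith)) univ_mem)
    exact ContinuousAt.comp' (f := fun p : ℝ × ℝ => (p.1 - t / 2, p.2))
      (g := fun p : ℝ × ℝ => V α h u θ (t / 2) t p.1 p.2) h2 (by fun_prop)
  refine h1.congr ?_
  filter_upwards [prod_mem_nhds (Ioo_mem_nhds (show t / 2 < t by linarith)
    (show t < t / 2 + t by linarith)) univ_mem] with p hp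
  exact (H.uxx_eq (by positivity) hp.1.1 hp.1.2.le _).symm

lemma uxx_bound (H : MildSol α h u θ K) {t : ℝ} (ht : 0 < t) :
    ∃ B, ∀ x, |uxx α h u θ t x| ≤ B := by
  obtain ⟨B, hB⟩ := H.dsrc_bound (t₀ := t / 2) (T := t) (by positivity) ht.le
  obtain ⟨B', hB'⟩ := H.ux_bound (t₀ := t / 2) (T := t / 2) (by positivity)
  refine ⟨m1 * B' / √(2 * (t - t / 2)) + √((t - t / 2) / 2) * |cE * B|, fun x => ?_⟩
  rw [H.uxx_eq (t₀ := t / 2) (T := t) (by positivity) (by linarith) (by linarith)]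
  exact W_bound (hB' _ le_rfl le_rfl) hB (t₀ := t - t / 2) (T := t - t / 2) (by linarith)
    le_rfl le_rfl x

lemma ut_right (H : MildSol α h u θ K) {t : ℝ} (ht : 0 < t) (x : ℝ) :
    HasDerivWithinAt (fun s => u s x) (uxx α h u θ t x + src α u θ t x) (Ici t) t := by
  obtain ⟨B2, hB2⟩ := H.uxx_bound ht
  obtain ⟨B1, hB1⟩ := H.ux_bound (t₀ := t) (T := t) ht
  have uxxc : Continuous (uxx α h u θ t) :=
    H.uxx_cont.comp_continuous (continuous_const.prodMk continuous_id) fun _ => ⟨ht, mem_univ _⟩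
  set R : ℝ → ℝ := fun s => (∫ σ in (0:ℝ)..1, 2 * σ * S (s * σ ^ 2) (uxx α h u θ t) x) +
    ∫ σ in (0:ℝ)..1, S (s * (1 - σ)) (src α u θ (t + s * σ)) x with hR
  have hfc : Continuous fun p : ℝ × ℝ => src α u θ (t + p.1) p.2 :=
    H.src_cont.comp (by fun_prop : Continuous fun p : ℝ × ℝ => (t + p.1, p.2))
  have hRc : Continuous R := by
    refine Continuous.add ?_ ?_
    · refine intervalIntegral.continuous_parametric_intervalIntegral_of_continuous'
        (f := fun s σ => 2 * σ * S (s * σ ^ 2) (uxx α h u θ t) x) ?_ 0 1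
      refine (by fun_prop : Continuous fun p : ℝ × ℝ => 2 * p.2).mul ?_
      exact (S_cont1 uxxc hB2).comp (by fun_prop : Continuous fun p : ℝ × ℝ => (p.1 * p.2 ^ 2, x))
    · refine intervalIntegral.continuous_parametric_intervalIntegral_of_continuous'
        (f := fun s σ => S (s * (1 - σ)) (src α u θ (t + s * σ)) x) ?_ 0 1
      exact S_cont_comp (f := fun s x => src α u θ (t + s) x) hfc (fun _ _ => H.src_bound _ _)
        (by fun_prop) (by fun_prop) (by fun_prop)
  have hR0 : R 0 = uxx α h u θ t x + src α u θ t x := by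
    simp only [hR, zero_mul, S_zero, add_zero]
    rw [intervalIntegral.integral_mul_const, intervalIntegral.integral_const_mul]
    simp
  have key : ∀ s, 0 ≤ s → u (t + s) x = u t x + s * R s := by
    intro s hs
    rw [H.restart ht.le hs]
    have := S_expand (H.uabs t) (H.ux_hasDerivAt ht) (H.uxx_hasDerivAt ht)
      (hB1 t le_rfl le_rfl) hB2 uxxc hs x
    simp only [hR, D]
    linarith
  have hd : HasDerivAt (fun s => u t x + (s - t) * R (s - t)) (R 0) t := by
    rw [hasDerivAt_iff_tendsto_slope]
    have : Tendsto (fun s => R (s - t)) (𝓝[≠] t) (𝓝 (R 0)) := by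
      have : Tendsto (fun s => R (s - t)) (𝓝 t) (𝓝 (R (t - t))) :=
        (hRc.comp (continuous_id.sub continuous_const)).continuousAt
      rw [sub_self] at this
      exact this.mono_left nhdsWithin_le_nhds
    refine this.congr' ?_
    filter_upwards [self_mem_nhdsWithin] with s hs
    have hs : s - t ≠ 0 := sub_ne_zero.2 hs
    simp [slope_def_field]
    field_simp
  rw [← hR0]
  refine hd.hasDerivWithinAt.congr (fun s hs => ?_) (by simp)
  have := key (s - t) (sub_nonneg.2 hs)
  rwa [add_sub_cancel] at this

lemma ut_hasDerivAt (H : MildSol α h u θ K) {t : ℝ} (ht : 0 < t) (x : ℝ) :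
    HasDerivAt (fun s => u s x) (uxx α h u θ t x + src α u θ t x) t := by
  refine right_deriv (ψ := fun t => uxx α h u θ t x + src α u θ t x) ?_ ?_
    (fun t ht => H.ut_right ht x) ht
  · exact (H.uc.comp (continuous_id.prodMk continuous_const)).continuousOn
  · have c1 : ContinuousOn (fun t => uxx α h u θ t x) (Ioi 0) :=
      ContinuousOn.comp (g := fun p : ℝ × ℝ => uxx α h u θ p.1 p.2) (f := fun t => (t, x))
        H.uxx_cont (by fun_prop) (fun t ht => ⟨ht, mem_univ _⟩)
    have c2 : Continuous (fun t => src α u θ t x) :=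
      Continuous.comp (g := fun p : ℝ × ℝ => src α u θ p.1 p.2) (f := fun t => (t, x))
        H.src_cont (by fun_prop)
    exact c1.add c2.continuousOn

end MildSol
end KPP

namespace KPP
open Filter Topology ProbabilityTheory

/-- the folding map of the line onto the unit interval -/
noncomputable def fold (x : ℝ) : ℝ := Real.arccos (Real.cos (π * x)) / π

lemma fold_cont : Continuous fold := by
  unfold fold; fun_prop

lemma fold_mem (x : ℝ) : fold x ∈ Icc (0:ℝ) 1 := by
  have := Real.pi_pos
  constructor
  · exact div_nonneg (Real.arccos_nonneg _) this.le
  · exact (div_le_one this).2 (Real.arccos_le_pi _)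

lemma fold_id {x : ℝ} (hx : x ∈ Icc (0:ℝ) 1) : fold x = x := by
  have := Real.pi_pos
  unfold fold
  rw [Real.arccos_cos (mul_nonneg this.le hx.1) (by nlinarith [hx.2])]
  field_simp

lemma fold_neg (x : ℝ) : fold (-x) = fold x := by
  unfold fold; rw [mul_neg, Real.cos_neg]

lemma fold_add (x : ℝ) : fold (x + 2) = fold x := by
  unfold fold
  rw [show π * (x + 2) = π * x + 2 * π by ring, Real.cos_add_two_pi]

lemma fold_apply {g : ℝ → ℝ} (he : ∀ x, g (-x) = g x) (hp : ∀ x, g (x + 2) = g x) (x : ℝ) :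
    g (fold x) = g x := by
  have hpi := Real.pi_pos
  have h1 : Real.cos (π * x) = Real.cos (π * fold x) := by
    rw [show π * fold x = Real.arccos (Real.cos (π * x)) by unfold fold; field_simp]
    rw [Real.cos_arccos (Real.neg_one_le_cos _) (Real.cos_le_one _)]
  have hper : Function.Periodic g 2 := hp
  obtain ⟨k, hk | hk⟩ := Real.cos_eq_cos_iff.1 h1
  · have : fold x = x + k * 2 := by
      have : π * fold x = π * (x + k * 2) := by rw [hk]; ring
      exact mul_left_cancel₀ hpi.ne' this
    rw [this]; exact hper.int_mul k x
  · have : fold x = -x + k * 2 := by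
      have : π * fold x = π * (-x + k * 2) := by rw [hk]; ring
      exact mul_left_cancel₀ hpi.ne' this
    rw [this, ← he x]; exact hper.int_mul k (-x)

lemma rpow_lip {α M a b : ℝ} (hα : 1 ≤ α) (ha : a ∈ Icc 0 M) (hb : b ∈ Icc 0 M) :
    |a ^ α - b ^ α| ≤ α * M ^ (α - 1) * |a - b| := by
  have := Convex.norm_image_sub_le_of_norm_hasDerivWithin_le (f := fun x : ℝ => x ^ α)
    (f' := fun x => α * x ^ (α - 1)) (s := Icc 0 M) (C := α * M ^ (α - 1)) (x := b) (y := a)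
    (fun x _ => (Real.hasDerivAt_rpow_const (Or.inr hα)).hasDerivWithinAt) ?_ (convex_Icc 0 M) hb ha
  · simpa [Real.norm_eq_abs] using this
  · intro x hx
    have h0 : 0 ≤ x ^ (α - 1) := Real.rpow_nonneg hx.1 _
    rw [Real.norm_eq_abs, abs_of_nonneg (by positivity)]
    have : x ^ (α - 1) ≤ M ^ (α - 1) := Real.rpow_le_rpow hx.1 hx.2 (by linarith)
    nlinarith

/-- truncated power -/
noncomputable def G (M α y : ℝ) : ℝ := (max 0 (min y M)) ^ α

/-- truncated logistic factor -/
noncomputable def th (m : ℝ) : ℝ := max 0 (min 1 (1 - m))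

lemma th_nonneg (m : ℝ) : 0 ≤ th m := le_max_left _ _
lemma th_le (m : ℝ) : th m ≤ 1 := max_le zero_le_one (min_le_left _ _)
lemma th_cont : Continuous th := by unfold th; fun_prop
lemma th_lip (a b : ℝ) : |th a - th b| ≤ |a - b| := by
  unfold th
  have h1 := abs_max_sub_max_le_abs (min 1 (1 - a)) (min 1 (1 - b)) 0
  have h2 := abs_min_sub_min_le_max 1 (1 - a) 1 (1 - b)
  rw [max_comm 0, max_comm 0]
  refine h1.trans (h2.trans ?_)
  rw [sub_self, abs_zero, max_eq_right (abs_nonneg _), show 1 - a - (1 - b) = b - a by ring,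
    abs_sub_comm]

section
variable {M α : ℝ}

lemma clip_mem (hM : 0 ≤ M) (y : ℝ) : max 0 (min y M) ∈ Icc 0 M :=
  ⟨le_max_left _ _, max_le hM (min_le_right _ _)⟩

lemma G_nonneg (y : ℝ) : 0 ≤ G M α y := Real.rpow_nonneg (le_max_left _ _) _

lemma G_le (hM : 0 ≤ M) (hα : 1 ≤ α) (y : ℝ) : G M α y ≤ M ^ α :=
  Real.rpow_le_rpow (le_max_left _ _) (clip_mem hM y).2 (by linarith)

lemma G_cont (hα : 1 ≤ α) : Continuous (G M α) :=
  Continuous.rpow_const (by fun_prop) fun _ => Or.inr (by linarith)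

lemma G_lip (hM : 0 ≤ M) (hα : 1 ≤ α) (a b : ℝ) :
    |G M α a - G M α b| ≤ α * M ^ (α - 1) * |a - b| := by
  refine (rpow_lip hα (clip_mem hM a) (clip_mem hM b)).trans ?_
  have : 0 ≤ M ^ (α - 1) := Real.rpow_nonneg hM _
  refine mul_le_mul_of_nonneg_left ?_ (by positivity)
  rw [max_comm 0, max_comm 0]
  refine (abs_max_sub_max_le_abs _ _ 0).trans ((abs_min_sub_min_le_max _ _ _ _).trans ?_)
  simp

/-- truncated nonlinearity -/
noncomputable def NN (M α : ℝ) (v : ℝ → ℝ → ℝ) (s x : ℝ) : ℝ :=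
  G M α (v s x) * th (∫ y in (0:ℝ)..1, v s y)

variable {v v₁ v₂ : ℝ → ℝ → ℝ}

lemma mass_cont (hv : Continuous fun p : ℝ × ℝ => v p.1 p.2) :
    Continuous fun s => ∫ y in (0:ℝ)..1, v s y :=
  intervalIntegral.continuous_parametric_intervalIntegral_of_continuous' (f := v) hv 0 1

lemma NN_cont (hα : 1 ≤ α) (hv : Continuous fun p : ℝ × ℝ => v p.1 p.2) :
    Continuous fun p : ℝ × ℝ => NN M α v p.1 p.2 :=
  ((G_cont hα).comp hv).mul (th_cont.comp ((mass_cont hv).comp continuous_fst))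

lemma NN_nonneg (s x : ℝ) : 0 ≤ NN M α v s x := mul_nonneg (G_nonneg _) (th_nonneg _)

lemma NN_abs (hM : 0 ≤ M) (hα : 1 ≤ α) (s x : ℝ) : |NN M α v s x| ≤ M ^ α := by
  rw [abs_of_nonneg (NN_nonneg s x), NN]
  have h1 := G_nonneg (M := M) (α := α) (v s x)
  have h2 := G_le hM hα (v s x)
  nlinarith [th_nonneg (∫ y in (0:ℝ)..1, v s y), th_le (∫ y in (0:ℝ)..1, v s y)]

lemma NN_lip (hM : 0 ≤ M) (hα : 1 ≤ α) (h1 : Continuous fun p : ℝ × ℝ => v₁ p.1 p.2)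
    (h2 : Continuous fun p : ℝ × ℝ => v₂ p.1 p.2) {s δ : ℝ} (hδ : ∀ x, |v₁ s x - v₂ s x| ≤ δ)
    (x : ℝ) : |NN M α v₁ s x - NN M α v₂ s x| ≤ (α * M ^ (α - 1) + M ^ α) * δ := by
  have c1 : Continuous (v₁ s) := h1.comp (continuous_const.prodMk continuous_id)
  have c2 : Continuous (v₂ s) := h2.comp (continuous_const.prodMk continuous_id)
  have hm : |(∫ y in (0:ℝ)..1, v₁ s y) - ∫ y in (0:ℝ)..1, v₂ s y| ≤ δ := by
    rw [← intervalIntegral.integral_sub (c1.intervalIntegrable _ _) (c2.intervalIntegrable _ _)]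
    have := intervalIntegral.norm_integral_le_of_norm_le_const (a := (0:ℝ)) (b := 1)
      (f := fun y => v₁ s y - v₂ s y) (C := δ) (fun y _ => hδ y)
    simpa using this
  have ht := (th_lip _ _).trans hm
  have hg := G_lip hM hα (v₁ s x) (v₂ s x)
  have hK : 0 ≤ α * M ^ (α - 1) := mul_nonneg (by linarith) (Real.rpow_nonneg hM _)
  have hg2 := hg.trans (mul_le_mul_of_nonneg_left (hδ x) hK)
  set a := th (∫ y in (0:ℝ)..1, v₁ s y)
  set b := th (∫ y in (0:ℝ)..1, v₂ s y)
  have hδ0 : 0 ≤ δ := (abs_nonneg _).trans (hδ 0)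
  have e : NN M α v₁ s x - NN M α v₂ s x =
      (G M α (v₁ s x) - G M α (v₂ s x)) * a + G M α (v₂ s x) * (a - b) := by
    simp only [NN]; ring
  rw [e]
  refine (abs_add_le _ _).trans ?_
  rw [abs_mul, abs_mul, abs_of_nonneg (th_nonneg _ : 0 ≤ a), abs_of_nonneg (G_nonneg _), add_mul]
  refine add_le_add ?_ ?_
  · have := th_le (∫ y in (0:ℝ)..1, v₁ s y)
    have h0 := th_nonneg (∫ y in (0:ℝ)..1, v₁ s y)
    calc _ ≤ α * M ^ (α - 1) * δ * 1 := by
          gcongr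
      _ = _ := mul_one _
  · exact mul_le_mul (G_le hM hα _) ht (abs_nonneg _) (Real.rpow_nonneg hM _)

/-- difference of Duhamel terms -/
lemma D_diff {f₁ f₂ : ℝ → ℝ → ℝ} {C A l t : ℝ} (c1 : Continuous fun p : ℝ × ℝ => f₁ p.1 p.2)
    (c2 : Continuous fun p : ℝ × ℝ => f₂ p.1 p.2) (b1 : ∀ s x, |f₁ s x| ≤ C)
    (b2 : ∀ s x, |f₂ s x| ≤ C) (hl : 0 < l) (hA : 0 ≤ A) (ht : 0 ≤ t)
    (hd : ∀ s, 0 ≤ s → ∀ x, |f₁ s x - f₂ s x| ≤ A * rexp (l * s)) (x : ℝ) :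
    |D f₁ t x - D f₂ t x| ≤ A / l * rexp (l * t) := by
  have cc : ∀ {f : ℝ → ℝ → ℝ}, (Continuous fun p : ℝ × ℝ => f p.1 p.2) → (∀ s x, |f s x| ≤ C) →
      Continuous fun s => S (t - s) (f s) x := fun hf hb =>
    S_cont_comp hf hb (by fun_prop) (by fun_prop) (by fun_prop)
  rw [D_eq, D_eq, ← intervalIntegral.integral_sub ((cc c1 b1).intervalIntegrable _ _)
    ((cc c2 b2).intervalIntegrable _ _)]
  have key : ∫ s in (0:ℝ)..t, A * rexp (l * s) = A / l * rexp (l * t) - A / l := by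
    rw [intervalIntegral.integral_eq_sub_of_hasDerivAt (f := fun s => A / l * rexp (l * s))]
    · simp
    · intro s _
      have : HasDerivAt (fun s => A / l * rexp (l * s)) (A / l * (rexp (l * s) * (l * 1))) s :=
        (((hasDerivAt_id s).const_mul l).exp).const_mul _
      have e : A / l * (rexp (l * s) * (l * 1)) = A * rexp (l * s) := by field_simp
      rwa [e] at this
    · exact (by fun_prop : Continuous fun s => A * rexp (l * s)).intervalIntegrable _ _
  have h2 := intervalIntegral.norm_integral_le_of_norm_le (μ := volume) (a := 0) (b := t)
    (f := fun s => S (t - s) (f₁ s) x - S (t - s) (f₂ s) x) (g := fun s => A * rexp (l * s)) ht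
    (Filter.Eventually.of_forall fun s hs => ?_)
    ((by fun_prop : Continuous fun s => A * rexp (l * s)).intervalIntegrable _ _)
  · rw [key] at h2
    have : 0 ≤ A / l := by positivity
    exact h2.trans (by linarith)
  · rw [S_sub (cont_right c1 s) (b1 s) (cont_right c2 s) (b2 s)]
    exact S_bound (hd s hs.1.le) _ _

end

/-- Global solvability of the truncated mild equation. -/
theorem trunc_exists {M α A : ℝ} {h : ℝ → ℝ} (hM : 0 < M) (hα : 1 ≤ α) (hc : Continuous h)
    (hb : ∀ x, |h x| ≤ A) (he : ∀ x, h (-x) = h x) (hp : ∀ x, h (x + 2) = h x) :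
    ∃ u : ℝ → ℝ → ℝ, (Continuous fun p : ℝ × ℝ => u p.1 p.2) ∧
      (∀ t x, u t x = u (max 0 t) x) ∧ (∀ t x, u t (-x) = u t x) ∧ (∀ t x, u t (x + 2) = u t x) ∧
      ∀ t, 0 ≤ t → ∀ x, u t x = S t h x + D (NN M α u) t x := by
  have hA : 0 ≤ A := (abs_nonneg _).trans (hb 0)
  set L := α * M ^ (α - 1) + M ^ α with hL
  have hMa : 0 < M ^ α := Real.rpow_pos_of_pos hM _
  have hL0 : 0 < L := by
    have : 0 < M ^ (α - 1) := Real.rpow_pos_of_pos hM _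
    positivity
  set l := 2 * L with hl
  have hl0 : 0 < l := by positivity
  let vOf : BoundedContinuousFunction (ℝ × ℝ) ℝ → ℝ → ℝ → ℝ := fun w s x =>
    rexp (l * max 0 s) * w (max 0 s, fold x)
  have vc : ∀ w, Continuous fun p : ℝ × ℝ => vOf w p.1 p.2 := by
    intro w
    refine Continuous.mul (by fun_prop) (w.continuous.comp ?_)
    exact (by fun_prop : Continuous fun p : ℝ × ℝ => max 0 p.1).prodMk
      (fold_cont.comp continuous_snd)
  have Nc := fun w => NN_cont (M := M) hα (vc w)
  have Nb := fun w => NN_abs (v := vOf w) hM.le hα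
  let Ψ0 : BoundedContinuousFunction (ℝ × ℝ) ℝ → ℝ × ℝ → ℝ := fun w p =>
    rexp (-(l * max 0 p.1)) * (S (max 0 p.1) h p.2 + D (NN M α (vOf w)) (max 0 p.1) p.2)
  have c0 : Continuous fun p : ℝ × ℝ => (max 0 p.1, p.2) := by fun_prop
  have Ψc : ∀ w, Continuous (Ψ0 w) := fun w =>
    Continuous.mul (by fun_prop)
      (((S_cont1 hc hb).comp c0).add ((D_cont (Nc w) (Nb w)).comp c0))
  have Ψb : ∀ w p, ‖Ψ0 w p‖ ≤ A + M ^ α / l := by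
    intro w p
    have ht : 0 ≤ max 0 p.1 := le_max_left _ _
    set t := max 0 p.1 with htdef
    simp only [Ψ0, ← htdef]
    rw [Real.norm_eq_abs, abs_mul, abs_of_pos (Real.exp_pos _)]
    have h1 := S_bound hb t p.2
    have h2 := D_bound (Nb w) ht p.2
    have h3 : |S t h p.2 + D (NN M α (vOf w)) t p.2| ≤ A + t * M ^ α :=
      (abs_add_le _ _).trans (add_le_add h1 h2)
    have h4 : l * t ≤ rexp (l * t) := by linarith [Real.add_one_le_exp (l * t)]
    have h5 : 1 ≤ rexp (l * t) := Real.one_le_exp (by positivity)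
    rw [Real.exp_neg, inv_mul_le_iff₀ (Real.exp_pos _)]
    refine h3.trans ?_
    rw [mul_add]
    refine add_le_add (by nlinarith) ?_
    calc t * M ^ α = (l * t) * (M ^ α / l) := by field_simp
      _ ≤ _ := mul_le_mul_of_nonneg_right h4 (by positivity)
  let Ψ : BoundedContinuousFunction (ℝ × ℝ) ℝ → BoundedContinuousFunction (ℝ × ℝ) ℝ := fun w =>
    BoundedContinuousFunction.ofNormedAddCommGroup (Ψ0 w) (Ψc w) _ (Ψb w)
  have hΨ : ContractingWith (1 / 2) Ψ := by
    refine ⟨by rw [← NNReal.coe_lt_coe]; norm_num, LipschitzWith.of_dist_le_mul fun w₁ w₂ => ?_⟩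
    rw [BoundedContinuousFunction.dist_le (by positivity)]
    intro p
    change dist (Ψ0 w₁ p) (Ψ0 w₂ p) ≤ _
    have ht : 0 ≤ max 0 p.1 := le_max_left _ _
    set t := max 0 p.1 with htdef
    have hd : ∀ s, 0 ≤ s → ∀ x, |NN M α (vOf w₁) s x - NN M α (vOf w₂) s x| ≤
        (L * dist w₁ w₂) * rexp (l * s) := by
      intro s hs x
      have := NN_lip (s := s) (δ := rexp (l * s) * dist w₁ w₂) hM.le hα (vc w₁) (vc w₂) ?_ x
      · refine this.trans (le_of_eq ?_)
        rw [← hL]; ring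
      · intro x
        simp only [vOf, max_eq_right hs]
        rw [← mul_sub, abs_mul, abs_of_pos (Real.exp_pos _)]
        refine mul_le_mul_of_nonneg_left ?_ (Real.exp_pos _).le
        exact BoundedContinuousFunction.dist_coe_le_dist (f := w₁) (g := w₂) (s, fold x)
    have := D_diff (Nc w₁) (Nc w₂) (Nb w₁) (Nb w₂) hl0 (by positivity) ht hd p.2
    simp only [Ψ0, ← htdef]
    rw [Real.dist_eq, ← mul_sub, add_sub_add_left_eq_sub, abs_mul, abs_of_pos (Real.exp_pos _),
      Real.exp_neg, inv_mul_le_iff₀ (Real.exp_pos _)]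
    refine this.trans (le_of_eq ?_)
    rw [hl]
    push_cast
    field_simp
  obtain ⟨w, hw⟩ : ∃ w, Ψ w = w := ⟨_, hΨ.fixedPoint_isFixedPt⟩
  have hw' : ∀ p, Ψ0 w p = w p := fun p => by
    have := congrArg (fun z : BoundedContinuousFunction (ℝ × ℝ) ℝ => z p) hw
    exact this
  refine ⟨fun t x => rexp (l * max 0 t) * w (max 0 t, x), ?_, ?_, ?_, ?_, ?_⟩
  · exact Continuous.mul (by fun_prop) (w.continuous.comp c0)
  · intro t x; simp
  all_goals
    have hu : ∀ t x, rexp (l * max 0 t) * w (max 0 t, x) =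
        S (max 0 t) h x + D (NN M α (vOf w)) (max 0 t) x := by
      intro t x
      rw [← hw']
      simp only [Ψ0]
      rw [max_eq_right (le_max_left 0 t), ← mul_assoc, ← Real.exp_add]
      simp
    have ev : ∀ t x, NN M α (vOf w) t (-x) = NN M α (vOf w) t x := by
      intro t x; simp only [NN, vOf, fold_neg]
    have pe : ∀ t x, NN M α (vOf w) t (x + 2) = NN M α (vOf w) t x := by
      intro t x; simp only [NN, vOf, fold_add]
    have E1 : ∀ t x, rexp (l * max 0 t) * w (max 0 t, -x) = rexp (l * max 0 t) * w (max 0 t, x) := by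
      intro t x
      rw [hu, hu, S_even hc he, D_even (Nc w) ev]
    have P1 : ∀ t x, rexp (l * max 0 t) * w (max 0 t, x + 2) =
        rexp (l * max 0 t) * w (max 0 t, x) := by
      intro t x
      rw [hu, hu, S_per hp, D_per pe]
  · exact E1
  · exact P1
  · intro t ht x
    have hut := hu t x
    rw [max_eq_right ht] at hut
    simp only [max_eq_right ht]
    rw [hut]
    congr 2
    ext s x
    have : vOf w = fun t x => rexp (l * max 0 t) * w (max 0 t, x) := by
      ext s x
      exact fold_apply (g := fun x => rexp (l * max 0 s) * w (max 0 s, x)) (E1 s) (P1 s) x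
    rw [this]

end KPP

namespace KPP
open Filter Topology ProbabilityTheory

lemma even_int {g : ℝ → ℝ} (hc : Continuous g) (he : ∀ x, g (-x) = g x) :
    ∫ x in (-1:ℝ)..1, g x = 2 * ∫ x in (0:ℝ)..1, g x := by
  rw [← intervalIntegral.integral_add_adjacent_intervals (b := 0) (hc.intervalIntegrable _ _)
    (hc.intervalIntegrable _ _)]
  have : ∫ x in (-1:ℝ)..0, g x = ∫ x in (0:ℝ)..1, g x := by
    have h1 := intervalIntegral.integral_comp_neg (a := 0) (b := 1) g
    simp only [he, neg_zero] at h1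
    exact h1.symm
  rw [this]; ring

lemma D_apriori {f : ℝ → ℝ → ℝ} {C B t x : ℝ} (fc : Continuous fun p : ℝ × ℝ => f p.1 p.2)
    (fb : ∀ s x, |f s x| ≤ C) (fp : ∀ s x, f s (x + 2) = f s x) (f0 : ∀ s x, 0 ≤ f s x)
    (ht : 0 ≤ t) (hB : ∀ s ∈ Icc 0 t, ∫ x in (-1:ℝ)..1, f s x ≤ 2 * B)
    (htot : ∀ r ∈ Icc 0 t, ∫ s in (0:ℝ)..r, ∫ x in (-1:ℝ)..1, f s x ≤ 2)
    (hx : x ∈ Icc (-1:ℝ) 1) :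
    D f t x ≤ (1 + 2 * m1) + (1 + 4 * m1) * B := by
  have hm := m1_nonneg
  set q : ℝ → ℝ := fun s => ∫ x in (-1:ℝ)..1, f s x with hq
  have q0 : ∀ s, 0 ≤ q s := fun s =>
    intervalIntegral.integral_nonneg (by norm_num) fun x _ => f0 s x
  have qc : Continuous q :=
    intervalIntegral.continuous_parametric_intervalIntegral_of_continuous' (f := f) fc (-1) 1
  have B0 : 0 ≤ B := by
    have := (q0 0).trans (hB 0 ⟨le_rfl, ht⟩); linarith
  have cS : Continuous fun s => S (t - s) (f s) x :=
    S_cont_comp fc fb (by fun_prop) (by fun_prop) (by fun_prop)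
  set t₀ := max 0 (t - 1) with ht₀
  have h00 : 0 ≤ t₀ := le_max_left _ _
  have h01 : t₀ ≤ t := max_le ht (by linarith)
  have h02 : t - t₀ ≤ 1 := by linarith [le_max_right 0 (t - 1)]
  have sup : ∀ s, s < t → S (t - s) (f s) x ≤ (1 / 2 + m1 / √(2 * (t - s))) * q s := fun s hs =>
    S_sup (cont_right fc s) (fb s) (fp s) (f0 s) (sub_pos.2 hs) hx
  rw [D_eq, ← intervalIntegral.integral_add_adjacent_intervals (b := t₀)
    (cS.intervalIntegrable _ _) (cS.intervalIntegrable _ _)]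
  refine add_le_add ?_ ?_
  · have h1 : ∫ s in (0:ℝ)..t₀, S (t - s) (f s) x ≤ ∫ s in (0:ℝ)..t₀, (1 / 2 + m1) * q s := by
      refine intervalIntegral.integral_mono_on_of_le_Ioo h00 (cS.intervalIntegrable _ _)
        ((continuous_const.mul qc).intervalIntegrable _ _) fun s hs => ?_
      have hs1 : 1 ≤ t - s := by
        have h3 := hs.2
        rw [ht₀, lt_max_iff] at h3
        rcases h3 with h3 | h3
        · exact absurd hs.1 (not_lt.2 h3.le)
        · linarith
      refine (sup s (by linarith)).trans ?_
      refine mul_le_mul_of_nonneg_right ?_ (q0 s)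
      have : 1 ≤ √(2 * (t - s)) := Real.one_le_sqrt.2 (by linarith)
      have := div_le_self hm this
      linarith
    rw [intervalIntegral.integral_const_mul] at h1
    have h2 := htot t₀ ⟨h00, h01⟩
    nlinarith
  · have hi : IntervalIntegrable (fun s => (t - s) ^ (-(1/2) : ℝ)) volume t₀ t := by
      have h := (intervalIntegral.intervalIntegrable_rpow' (a := 0) (b := t - t₀) (r := -(1/2))
        (by norm_num)).comp_sub_left t
      simp only [sub_zero, sub_sub_cancel] at h
      exact h.symm
    have hv : ∫ s in t₀..t, (t - s) ^ (-(1/2) : ℝ) ≤ 2 := by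
      rw [intervalIntegral.integral_comp_sub_left (fun r => r ^ (-(1/2) : ℝ)) t, sub_self,
        integral_rpow (Or.inl (by norm_num))]
      have : (t - t₀) ^ (-(1/2) + 1 : ℝ) ≤ 1 :=
        Real.rpow_le_one (by linarith) h02 (by norm_num)
      rw [Real.zero_rpow (by norm_num)]
      rw [div_le_iff₀ (by norm_num)]
      linarith
    have h1 : ∫ s in t₀..t, S (t - s) (f s) x ≤
        ∫ s in t₀..t, (B + 2 * m1 * B * (t - s) ^ (-(1/2) : ℝ)) := by
      refine intervalIntegral.integral_mono_on_of_le_Ioo h01 (cS.intervalIntegrable _ _)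
        ((continuous_const.intervalIntegrable _ _).add (hi.const_mul _)) fun s hs => ?_
      have hts : 0 < t - s := sub_pos.2 hs.2
      refine (sup s hs.2).trans ?_
      have h2 := hB s ⟨h00.trans hs.1.le, hs.2.le⟩
      have e : (t - s) ^ (-(1/2) : ℝ) = (√(t - s))⁻¹ := by
        rw [Real.rpow_neg hts.le, Real.sqrt_eq_rpow]
      have h3 : m1 / √(2 * (t - s)) ≤ m1 * (√(t - s))⁻¹ := by
        rw [← div_eq_mul_inv]
        have := Real.sqrt_pos.2 hts
        gcongr
        linarith
      rw [e]
      calc _ ≤ (1 / 2 + m1 * (√(t - s))⁻¹) * (2 * B) := by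
            refine mul_le_mul (by linarith) h2 (q0 s) (by positivity)
        _ = _ := by ring
    refine h1.trans ?_
    rw [intervalIntegral.integral_add (continuous_const.intervalIntegrable _ _) (hi.const_mul _),
      intervalIntegral.integral_const, intervalIntegral.integral_const_mul, smul_eq_mul]
    have h5 : 0 ≤ 2 * m1 * B := by positivity
    nlinarith [mul_le_mul_of_nonneg_left hv h5]

lemma exists_cutoff {α a b : ℝ} (hα2 : α < 2) (hb : 0 ≤ b) :
    ∃ M, 0 < M ∧ ∀ y, 0 ≤ y → y ≤ a + b * y ^ (α - 1) → y ≤ M := by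
  have h1 := tendsto_rpow_neg_atTop (show 0 < 2 - α by linarith)
  have h2 : ∀ᶠ y : ℝ in atTop, y ^ (-(2 - α)) < 1 / (2 * (b + 1)) :=
    h1.eventually_lt_const (by positivity)
  obtain ⟨M, hM⟩ := (h2.and ((eventually_gt_atTop (2 * a)).and (eventually_gt_atTop 0))).exists_forall_of_atTop
  refine ⟨M, (hM M le_rfl).2.2, fun y hy h => ?_⟩
  by_contra hlt
  obtain ⟨h3, h4, h5⟩ := hM y (not_le.1 hlt).le
  have e : y ^ (α - 1) = y ^ (-(2 - α)) * y := by
    rw [← Real.rpow_add_one h5.ne']; ring_nf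
  have h6 : b * y ^ (-(2 - α)) ≤ 1 / 2 := by
    have h7 : 0 ≤ y ^ (-(2 - α)) := Real.rpow_nonneg hy _
    rw [lt_div_iff₀ (by positivity)] at h3
    nlinarith
  rw [e, ← mul_assoc] at h
  nlinarith

/-- Existence of a global nonnegative bounded mild solution. -/
theorem mild_exists {α A : ℝ} {h : ℝ → ℝ} (hα1 : 1 ≤ α) (hα2 : α < 2) (hc : Continuous h)
    (hb : ∀ x, |h x| ≤ A) (he : ∀ x, h (-x) = h x) (hp : ∀ x, h (x + 2) = h x)
    (h0 : ∀ x, 0 ≤ h x) (hm0 : ∫ x in (0:ℝ)..1, h x < 1) :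
    ∃ (u : ℝ → ℝ → ℝ) (K : ℝ), MildSol α h u (fun s => 1 - ∫ y in (0:ℝ)..1, u s y) K ∧
      (∀ t x, u t (-x) = u t x) ∧ (∀ t x, u t (x + 2) = u t x) := by
  have hm := m1_nonneg
  obtain ⟨M, hM, hcut⟩ := exists_cutoff (a := A + (1 + 2 * m1)) (b := 1 + 4 * m1) hα2
    (by positivity)
  obtain ⟨u, uc, uz, ue, up, umild⟩ := trunc_exists hM hα1 hc hb he hp
  set f := NN M α u with hf
  have fc : Continuous fun p : ℝ × ℝ => f p.1 p.2 := NN_cont hα1 uc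
  have fb : ∀ s x, |f s x| ≤ M ^ α := NN_abs hM.le hα1
  have f0 : ∀ s x, 0 ≤ f s x := NN_nonneg
  have fe : ∀ s x, f s (-x) = f s x := fun s x => by simp only [hf, NN, ue]
  have fp : ∀ s x, f s (x + 2) = f s x := fun s x => by simp only [hf, NN, up]
  have u0' : ∀ t, 0 ≤ t → ∀ x, 0 ≤ u t x := fun t ht x => by
    rw [umild t ht]; exact add_nonneg (S_nonneg h0 t x) (D_nonneg f0 ht x)
  have u0 : ∀ t x, 0 ≤ u t x := fun t x => by rw [uz]; exact u0' _ (le_max_left _ _) x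
  set m : ℝ → ℝ := fun s => ∫ y in (0:ℝ)..1, u s y with hmdef
  set p : ℝ → ℝ := fun s => ∫ y in (0:ℝ)..1, f s y with hpdef
  have mc : Continuous m := mass_cont uc
  have pc : Continuous p := mass_cont fc
  have m_nonneg : ∀ t, 0 ≤ m t := fun t =>
    intervalIntegral.integral_nonneg zero_le_one fun y _ => u0 t y
  have p_nonneg : ∀ t, 0 ≤ p t := fun t =>
    intervalIntegral.integral_nonneg zero_le_one fun y _ => f0 t y
  have q_eq : ∀ s, ∫ x in (-1:ℝ)..1, f s x = 2 * p s := fun s =>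
    even_int (cont_right fc s) (fe s)
  have m_eq : ∀ t, 0 ≤ t → m t = (∫ x in (0:ℝ)..1, h x) + ∫ s in (0:ℝ)..t, p s := by
    intro t ht
    have h1 : ∫ x in (-1:ℝ)..1, u t x = 2 * m t := even_int (cont_right uc t) (ue t)
    have h2 : ∫ x in (-1:ℝ)..1, u t x =
        (∫ x in (-1:ℝ)..1, h x) + ∫ s in (0:ℝ)..t, ∫ x in (-1:ℝ)..1, f s x := by
      rw [← S_mass hc hb hp t, ← D_mass fc fb fp t, ← intervalIntegral.integral_add]
      · exact intervalIntegral.integral_congr fun x _ => umild t ht x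
      · exact ((S_cont1 hc hb).comp (continuous_const.prodMk continuous_id)).intervalIntegrable _ _
      · exact ((D_cont fc fb).comp (continuous_const.prodMk continuous_id)).intervalIntegrable _ _
    simp only [q_eq] at h2
    rw [intervalIntegral.integral_const_mul, even_int hc he] at h2
    linarith
  have m_diff : ∀ r t, 0 ≤ r → 0 ≤ t → m t = m r + ∫ s in r..t, p s := by
    intro r t hr ht
    rw [m_eq t ht, m_eq r hr, add_assoc, intervalIntegral.integral_add_adjacent_intervals
      (pc.intervalIntegrable _ _) (pc.intervalIntegrable _ _)]
  have m_mono : ∀ r t, 0 ≤ r → r ≤ t → m r ≤ m t := by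
    intro r t hr hrt
    rw [m_diff r t hr (hr.trans hrt)]
    linarith [intervalIntegral.integral_nonneg (μ := volume) hrt fun s _ => p_nonneg s]
  have m0 : m 0 < 1 := by rw [m_eq 0 le_rfl]; simpa using hm0
  have m_le' : ∀ t, 0 ≤ t → m t ≤ 1 := by
    intro t ht
    by_contra hlt
    rw [not_le] at hlt
    obtain ⟨r, hr, hr1⟩ := intermediate_value_Icc ht mc.continuousOn (show (1:ℝ) ∈ Icc (m 0) (m t)
      from ⟨m0.le, hlt.le⟩)
    have h1 := m_diff r t hr.1 ht
    have h2 : ∫ s in r..t, p s = ∫ s in r..t, (0:ℝ) := by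
      refine intervalIntegral.integral_congr fun s hs => ?_
      rw [uIcc_of_le hr.2] at hs
      have h3 := m_mono r s hr.1 hs.1
      have h4 : th (m s) = 0 := by
        unfold th
        rw [max_eq_left]
        exact (min_le_right _ _).trans (by linarith)
      have h5 : ∀ y, f s y = 0 := fun y => by
        simp only [hf, NN]
        change _ * th (m s) = 0
        rw [h4, mul_zero]
      simp only [hpdef, h5, intervalIntegral.integral_zero]
    rw [h2, intervalIntegral.integral_zero] at h1
    linarith
  have mz : ∀ t, m t = m (max 0 t) := fun t => by
    simp only [hmdef]
    exact intervalIntegral.integral_congr fun x _ => uz t x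
  have m_le : ∀ t, m t ≤ 1 := fun t => by rw [mz]; exact m_le' _ (le_max_left _ _)
  have th_eq : ∀ t, th (m t) = 1 - m t := fun t => by
    unfold th
    rw [min_eq_right (by linarith [m_nonneg t]), max_eq_right (by linarith [m_le t])]
  -- a priori bound
  have ub1 : ∀ T, 0 ≤ T → ∀ x ∈ Icc (0:ℝ) 1, u T x ≤ M := by
    intro T hT x hx
    obtain ⟨⟨t, y⟩, ⟨htm, hym⟩, hmax⟩ := (isCompact_Icc.prod isCompact_Icc).exists_isMaxOn
      (s := Icc (0:ℝ) T ×ˢ Icc (0:ℝ) 1) ⟨(0, 0), ⟨le_rfl, hT⟩, ⟨le_rfl, zero_le_one⟩⟩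
      uc.continuousOn
    have hK : ∀ s ∈ Icc (0:ℝ) T, ∀ z ∈ Icc (0:ℝ) 1, u s z ≤ u t y := fun s hs z hz =>
      hmax (show (s, z) ∈ _ from ⟨hs, hz⟩)
    refine (hK T ⟨hT, le_rfl⟩ x hx).trans (hcut _ (u0 t y) ?_)
    have hpB : ∀ s ∈ Icc (0:ℝ) t, ∫ x in (-1:ℝ)..1, f s x ≤ 2 * u t y ^ (α - 1) := by
      intro s hs
      rw [q_eq]
      refine mul_le_mul_of_nonneg_left ?_ zero_le_two
      have h1 : p s ≤ ∫ z in (0:ℝ)..1, u t y ^ (α - 1) * u s z := by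
        refine intervalIntegral.integral_mono_on zero_le_one
          ((cont_right fc s).intervalIntegrable _ _)
          ((continuous_const.mul (cont_right uc s)).intervalIntegrable _ _) fun z hz => ?_
        have hz0 := u0 s z
        have h2 : G M α (u s z) ≤ u s z ^ α :=
          Real.rpow_le_rpow (le_max_left _ _) (max_le hz0 (min_le_left _ _)) (by linarith)
        have h3 : u s z ^ α = u s z ^ (α - 1) * u s z := by
          rw [← Real.rpow_add_one' hz0 (by linarith)]; ring_nf
        have h4 : u s z ^ (α - 1) ≤ u t y ^ (α - 1) :=
          Real.rpow_le_rpow hz0 (hK s ⟨hs.1, hs.2.trans htm.2⟩ z hz) (by linarith)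
        calc f s z ≤ G M α (u s z) * 1 :=
              mul_le_mul_of_nonneg_left (th_le _) (G_nonneg _)
          _ ≤ u s z ^ (α - 1) * u s z := by rw [mul_one, ← h3]; exact h2
          _ ≤ _ := mul_le_mul_of_nonneg_right h4 hz0
      rw [intervalIntegral.integral_const_mul] at h1
      refine h1.trans (mul_le_of_le_one_right (Real.rpow_nonneg (u0 t y) _) (m_le s))
    have htot : ∀ r ∈ Icc (0:ℝ) t, ∫ s in (0:ℝ)..r, ∫ x in (-1:ℝ)..1, f s x ≤ 2 := by
      intro r hr
      simp only [q_eq]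
      rw [intervalIntegral.integral_const_mul]
      have := m_diff 0 r le_rfl hr.1
      linarith [m_le r, m_nonneg 0]
    have hD := D_apriori fc fb fp f0 htm.1 hpB htot (x := y) ⟨by linarith [hym.1], hym.2⟩
    have hS := (le_abs_self _).trans (S_bound hb t y)
    conv_lhs => rw [umild t htm.1 y]
    linarith
  have ub2 : ∀ t x, u t x ≤ M := by
    intro t x
    rw [uz, ← fold_apply (ue _) (up _) x]
    exact ub1 _ (le_max_left _ _) _ (fold_mem x)
  refine ⟨u, M, ⟨hα1, hc, ?_, uc, u0, ub2, continuous_const.sub mc, ?_, ?_, ?_⟩, ue, up⟩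
  · intro x
    have : u 0 x = h x := by rw [umild 0 le_rfl]; simp [D]
    rw [← this, abs_of_nonneg (u0 0 x)]
    exact ub2 0 x
  · exact fun t => by linarith [m_le t]
  · exact fun t => by linarith [m_nonneg t]
  · intro t ht x
    rw [umild t ht]
    have : f = fun s x => u s x ^ α * (1 - ∫ y in (0:ℝ)..1, u s y) := by
      ext s x
      simp only [hf, NN]
      change _ * th (m s) = _ * (1 - m s)
      rw [th_eq, G, min_eq_left (ub2 s x), max_eq_right (u0 s x)]
    rw [this]

end KPP

namespace KPP
open Filter Topology ProbabilityTheory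

theorem existence {α : ℝ} (hα1 : 1 ≤ α) (hα2 : α < 2)
    {u₀ : ℝ → ℝ} (hc : ContinuousOn u₀ (Icc 0 1))
    (h0 : ∀ x ∈ Icc (0:ℝ) 1, 0 ≤ u₀ x)
    (hm : (∫ x in (0:ℝ)..1, u₀ x) < 1) :
    ∃ u ut ux uxx : ℝ → ℝ → ℝ, IsKPPSolution α u ut ux uxx ∧ KPPNonneg u ∧
        ∀ x ∈ Icc (0:ℝ) 1, u 0 x = u₀ x := by
  obtain ⟨A, hA⟩ := isCompact_Icc.exists_bound_of_continuousOn hc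
  obtain ⟨u, K, H, ue, up⟩ := mild_exists (α := α) (A := A) (h := fun x => u₀ (fold x)) hα1 hα2
    (hc.comp_continuous fold_cont fold_mem) (fun x => hA _ (fold_mem x))
    (fun x => by rw [fold_neg]) (fun x => by rw [fold_add]) (fun x => h0 _ (fold_mem x)) (by
      rw [intervalIntegral.integral_congr (g := u₀)]
      · exact hm
      · intro x hx
        rw [uIcc_of_le zero_le_one] at hx
        simp only [fold_id hx])
  set h : ℝ → ℝ := fun x => u₀ (fold x) with hh
  set θ : ℝ → ℝ := fun s => 1 - ∫ y in (0:ℝ)..1, u s y with hθ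
  have hsub : Ioi (0:ℝ) ×ˢ Icc (0:ℝ) 1 ⊆ Ioi 0 ×ˢ univ := prod_mono le_rfl (subset_univ _)
  refine ⟨u, fun t x => MildSol.uxx α h u θ t x + MildSol.src α u θ t x, MildSol.ux α h u θ,
    MildSol.uxx α h u θ, ⟨H.uc.continuousOn, ?_, H.ux_cont.mono hsub, H.uxx_cont.mono hsub,
      fun t ht x _ => H.ut_hasDerivAt ht x,
      fun t ht x _ => (H.ux_hasDerivAt ht x).hasDerivWithinAt,
      fun t ht x _ => (H.uxx_hasDerivAt ht x).hasDerivWithinAt, fun t _ x _ => rfl, ?_⟩,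
    fun t _ x _ => H.u0 t x, ?_⟩
  · exact (H.uxx_cont.mono hsub).add H.src_cont.continuousOn
  · intro t ht
    have ht : (0:ℝ) < t := ht
    constructor
    · have h1 := H.ux_hasDerivAt ht 0
      have h2 : HasDerivAt (fun x => u t (-x)) (MildSol.ux α h u θ t 0 * (-1)) 0 :=
        HasDerivAt.comp (h₂ := u t) (h := fun x => -x) 0 (by simpa using h1) (hasDerivAt_neg 0)
      have e : (fun x => u t (-x)) = u t := funext (ue t)
      rw [e] at h2
      linarith [h1.unique h2]
    · have h1 := H.ux_hasDerivAt ht 1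
      have h2 : HasDerivAt (fun x => u t (2 - x)) (MildSol.ux α h u θ t 1 * (-1)) 1 :=
        HasDerivAt.comp (h₂ := u t) (h := fun x => 2 - x) 1
          (by norm_num; exact h1) ((hasDerivAt_id (1:ℝ)).const_sub 2)
      have e : (fun x => u t (2 - x)) = u t := funext fun x => by
        rw [show 2 - x = -x + 2 by ring, up, ue]
      rw [e] at h2
      linarith [h1.unique h2]
  · intro x hx
    rw [H.mild 0 le_rfl]
    simp [D, hh, fold_id hx]

/-- clamping to the quarter strip -/
noncomputable def cl (u : ℝ → ℝ → ℝ) (t x : ℝ) : ℝ := u (max 0 t) (max 0 (min x 1))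

lemma cl_cont {u : ℝ → ℝ → ℝ}
    (h : ContinuousOn (fun p : ℝ × ℝ => u p.1 p.2) (Ici 0 ×ˢ Icc 0 1)) :
    Continuous fun p : ℝ × ℝ => cl u p.1 p.2 :=
  h.comp_continuous (f := fun p : ℝ × ℝ => (max 0 p.1, max 0 (min p.2 1))) (by fun_prop)
    fun p => ⟨le_max_left (0:ℝ) p.1, le_max_left _ _, max_le zero_le_one (min_le_right _ _)⟩

lemma cl_eq (u : ℝ → ℝ → ℝ) {t x : ℝ} (ht : 0 ≤ t) (hx : x ∈ Icc (0:ℝ) 1) : cl u t x = u t x := by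
  unfold cl; rw [max_eq_right ht, min_eq_left hx.2, max_eq_right hx.1]

lemma slice {w : ℝ → ℝ → ℝ} {s : Set ℝ}
    (h : ContinuousOn (fun p : ℝ × ℝ => w p.1 p.2) (s ×ˢ Icc 0 1)) {t : ℝ} (ht : t ∈ s) :
    ContinuousOn (w t) (Icc 0 1) :=
  ContinuousOn.comp (g := fun p : ℝ × ℝ => w p.1 p.2) (f := fun x => (t, x)) h
    (by fun_prop) fun _ hx => ⟨ht, hx⟩

lemma ii {g : ℝ → ℝ} (h : ContinuousOn g (Icc 0 1)) : IntervalIntegrable g volume 0 1 :=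
  ContinuousOn.intervalIntegrable (by rwa [uIcc_of_le zero_le_one])

/-- differentiation of the energy -/
lemma energy_deriv {w wt : ℝ → ℝ → ℝ}
    (wc : ContinuousOn (fun p : ℝ × ℝ => w p.1 p.2) (Ici 0 ×ˢ Icc 0 1))
    (wtc : ContinuousOn (fun p : ℝ × ℝ => wt p.1 p.2) (Ioi 0 ×ˢ Icc 0 1))
    (hd : ∀ t ∈ Ioi (0:ℝ), ∀ x ∈ Icc (0:ℝ) 1, HasDerivAt (fun s => w s x) (wt t x) t)
    {t : ℝ} (ht : 0 < t) :
    HasDerivAt (fun t => ∫ x in (0:ℝ)..1, w t x ^ 2) (∫ x in (0:ℝ)..1, 2 * w t x * wt t x) t := by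
  have wc' : ContinuousOn (fun p : ℝ × ℝ => w p.1 p.2) (Ioi 0 ×ˢ Icc 0 1) :=
    wc.mono (prod_mono Ioi_subset_Ici_self le_rfl)
  have gc : ContinuousOn (fun p : ℝ × ℝ => 2 * w p.1 p.2 * wt p.1 p.2) (Ioi 0 ×ˢ Icc 0 1) :=
    (continuousOn_const.mul wc').mul wtc
  have hsub : Icc (t / 2) (2 * t) ×ˢ Icc (0:ℝ) 1 ⊆ Ioi 0 ×ˢ Icc 0 1 :=
    prod_mono (fun s hs => lt_of_lt_of_le (by positivity) hs.1) le_rfl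
  obtain ⟨B, hB⟩ := (isCompact_Icc.prod isCompact_Icc).exists_bound_of_continuousOn (gc.mono hsub)
  have hI : ∀ x ∈ Set.uIoc (0:ℝ) 1, x ∈ Icc (0:ℝ) 1 := fun x hx => by
    rw [uIoc_of_le zero_le_one] at hx; exact Ioc_subset_Icc_self hx
  refine (intervalIntegral.hasDerivAt_integral_of_dominated_loc_of_deriv_le
    (F := fun t x => w t x ^ 2) (F' := fun t x => 2 * w t x * wt t x) (bound := fun _ => B)
    (s := Icc (t / 2) (2 * t)) (Icc_mem_nhds (by linarith) (by linarith)) ?_ ?_ ?_ ?_ ?_ ?_).2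
  · filter_upwards [Ioi_mem_nhds ht] with s hs
    have h1 := ii ((slice wc' hs).pow 2)
    exact h1.aestronglyMeasurable_restrict_uIoc
  · exact ii ((slice wc' ht).pow 2)
  · have h1 := ii (slice (w := fun t x => 2 * w t x * wt t x) gc ht)
    exact h1.aestronglyMeasurable_restrict_uIoc
  · exact Filter.Eventually.of_forall fun x hx s hs => hB (s, x) ⟨hs, hI x hx⟩
  · exact intervalIntegrable_const
  · refine Filter.Eventually.of_forall fun x hx s hs => ?_
    have := (hd s (lt_of_lt_of_le (by positivity) hs.1) x (hI x hx)).fun_pow 2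
    simpa using this

theorem uniqueness {α : ℝ} (hα1 : 1 ≤ α) {u₁ ut₁ ux₁ uxx₁ u₂ ut₂ ux₂ uxx₂ : ℝ → ℝ → ℝ}
    (H1 : IsKPPSolution α u₁ ut₁ ux₁ uxx₁) (N1 : KPPNonneg u₁)
    (H2 : IsKPPSolution α u₂ ut₂ ux₂ uxx₂) (N2 : KPPNonneg u₂)
    (h0 : ∀ x ∈ Icc (0:ℝ) 1, u₁ 0 x = u₂ 0 x) {T : ℝ} (hT : 0 ≤ T) {x : ℝ}
    (hx : x ∈ Icc (0:ℝ) 1) : u₁ T x = u₂ T x := by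
  obtain ⟨c1, ct1, cx1, cxx1, dt1, dx1, dxx1, eq1, bc1⟩ := H1
  obtain ⟨c2, ct2, cx2, cxx2, dt2, dx2, dxx2, eq2, bc2⟩ := H2
  -- bounds
  have hsubT : Icc (0:ℝ) T ×ˢ Icc (0:ℝ) 1 ⊆ Ici 0 ×ˢ Icc 0 1 := prod_mono (fun s hs => hs.1) le_rfl
  obtain ⟨M1, hM1⟩ := (isCompact_Icc.prod isCompact_Icc).exists_bound_of_continuousOn
    (c1.mono hsubT)
  obtain ⟨M2, hM2⟩ := (isCompact_Icc.prod isCompact_Icc).exists_bound_of_continuousOn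
    (c2.mono hsubT)
  set M := max M1 M2 with hM
  have b1 : ∀ t ∈ Icc (0:ℝ) T, ∀ x ∈ Icc (0:ℝ) 1, u₁ t x ∈ Icc 0 M := fun t ht x hx =>
    ⟨N1 t ht.1 x hx, ((le_abs_self _).trans (hM1 (t, x) ⟨ht, hx⟩)).trans (le_max_left _ _)⟩
  have b2 : ∀ t ∈ Icc (0:ℝ) T, ∀ x ∈ Icc (0:ℝ) 1, u₂ t x ∈ Icc 0 M := fun t ht x hx =>
    ⟨N2 t ht.1 x hx, ((le_abs_self _).trans (hM2 (t, x) ⟨ht, hx⟩)).trans (le_max_right _ _)⟩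
  have hM0 : 0 ≤ M := (b1 0 ⟨le_rfl, hT⟩ 0 ⟨le_rfl, zero_le_one⟩).1.trans
    (b1 0 ⟨le_rfl, hT⟩ 0 ⟨le_rfl, zero_le_one⟩).2
  set L := α * M ^ (α - 1) with hL
  have hL0 : 0 ≤ L := mul_nonneg (by linarith) (Real.rpow_nonneg hM0 _)
  have hMa : 0 ≤ M ^ α := Real.rpow_nonneg hM0 _
  set c := 2 * L * (1 + M) + 2 * M ^ α with hcdef
  set w : ℝ → ℝ → ℝ := fun t x => u₁ t x - u₂ t x with hw
  have wc : ContinuousOn (fun p : ℝ × ℝ => w p.1 p.2) (Ici 0 ×ˢ Icc 0 1) := c1.sub c2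
  have wd : ∀ t ∈ Ioi (0:ℝ), ∀ x ∈ Icc (0:ℝ) 1,
      HasDerivAt (fun s => w s x) (ut₁ t x - ut₂ t x) t := fun t ht x hx =>
    (dt1 t ht x hx).sub (dt2 t ht x hx)
  set En : ℝ → ℝ := fun t => ∫ x in (0:ℝ)..1, w t x ^ 2 with hEn
  have dE := fun (t : ℝ) (ht : 0 < t) => energy_deriv (wt := fun t x => ut₁ t x - ut₂ t x) wc
    (ct1.sub ct2) wd ht
  have cE : ContinuousOn En (Ici 0) := by
    have h1 : Continuous fun t => ∫ x in (0:ℝ)..1, cl w t x ^ 2 :=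
      intervalIntegral.continuous_parametric_intervalIntegral_of_continuous'
        (f := fun t x => cl w t x ^ 2) ((continuous_pow 2).comp (cl_cont wc)) 0 1
    refine h1.continuousOn.congr fun t ht => ?_
    refine intervalIntegral.integral_congr fun x hx => ?_
    rw [uIcc_of_le zero_le_one] at hx
    simp only [cl_eq w ht hx]
  have E0 : En 0 = 0 := by
    have : En 0 = ∫ x in (0:ℝ)..1, (0:ℝ) := by
      refine intervalIntegral.integral_congr fun x hx => ?_
      rw [uIcc_of_le zero_le_one] at hx
      simp [hw, h0 x hx]
    simpa using this
  have key : ∀ t ∈ Ioo (0:ℝ) T,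
      ∫ x in (0:ℝ)..1, 2 * w t x * (ut₁ t x - ut₂ t x) ≤ c * En t := by
    intro t ht
    have ht0 : t ∈ Ioi (0:ℝ) := ht.1
    have htT : t ∈ Icc (0:ℝ) T := ⟨ht.1.le, ht.2.le⟩
    have htI : t ∈ Ici (0:ℝ) := ht.1.le
    set m₁ := ∫ y in (0:ℝ)..1, u₁ t y with hm₁
    set m₂ := ∫ y in (0:ℝ)..1, u₂ t y with hm₂
    have s1 := slice c1 htI
    have s2 := slice c2 htI
    have sw : ContinuousOn (w t) (Icc 0 1) := slice wc htI
    have swt : ContinuousOn (fun x => ut₁ t x - ut₂ t x) (Icc 0 1) :=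
      (slice ct1 ht0).sub (slice ct2 ht0)
    have swx : ContinuousOn (fun x => ux₁ t x - ux₂ t x) (Icc 0 1) :=
      (slice cx1 ht0).sub (slice cx2 ht0)
    have swxx : ContinuousOn (fun x => uxx₁ t x - uxx₂ t x) (Icc 0 1) :=
      (slice cxx1 ht0).sub (slice cxx2 ht0)
    have m1M : 0 ≤ m₁ ∧ m₁ ≤ M := by
      refine ⟨intervalIntegral.integral_nonneg zero_le_one fun y hy => (b1 t htT y hy).1, ?_⟩
      have := intervalIntegral.integral_mono_on zero_le_one (ii s1)
        (intervalIntegrable_const (c := M)) fun y hy => (b1 t htT y hy).2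
      simpa using this
    set d := m₁ - m₂ with hd
    have dw : d = ∫ y in (0:ℝ)..1, w t y := by
      rw [hd, hm₁, hm₂, ← intervalIntegral.integral_sub (ii s1) (ii s2)]
    have iw := ii sw
    have iw2 : IntervalIntegrable (fun x => w t x ^ 2) volume 0 1 := ii (sw.pow 2)
    have d2 : d ^ 2 ≤ En t := by
      have h1 : 0 ≤ ∫ y in (0:ℝ)..1, (w t y ^ 2 - 2 * d * w t y + d ^ 2) :=
        intervalIntegral.integral_nonneg zero_le_one fun y _ => by nlinarith [sq_nonneg (w t y - d)]
      rw [intervalIntegral.integral_add (iw2.sub (iw.const_mul _)) intervalIntegrable_const,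
        intervalIntegral.integral_sub iw2 (iw.const_mul _), intervalIntegral.integral_const_mul,
        ← dw] at h1
      simp only [intervalIntegral.integral_const, sub_zero, smul_eq_mul, one_mul] at h1
      change 0 ≤ En t - _ + _ at h1
      nlinarith
    -- integration by parts
    have parts : ∫ y in (0:ℝ)..1, ((ux₁ t y - ux₂ t y) * (ux₁ t y - ux₂ t y) +
        w t y * (uxx₁ t y - uxx₂ t y)) = 0 := by
      rw [intervalIntegral.integral_eq_sub_of_hasDerivAt_of_le zero_le_one
        (f := fun y => w t y * (ux₁ t y - ux₂ t y)) (sw.mul swx)]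
      · simp [(bc1 t ht0).1, (bc1 t ht0).2, (bc2 t ht0).1, (bc2 t ht0).2]
      · intro y hy
        have hyI : y ∈ Icc (0:ℝ) 1 := Ioo_subset_Icc_self hy
        have hn : Icc (0:ℝ) 1 ∈ 𝓝 y := Icc_mem_nhds hy.1 hy.2
        exact (((dx1 t ht0 y hyI).hasDerivAt hn).sub ((dx2 t ht0 y hyI).hasDerivAt hn)).mul
          (((dxx1 t ht0 y hyI).hasDerivAt hn).sub ((dxx2 t ht0 y hyI).hasDerivAt hn))
      · exact ii ((swx.mul swx).add (sw.mul swxx))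
    have pt : ∀ y ∈ Icc (0:ℝ) 1, 2 * w t y * (ut₁ t y - ut₂ t y) ≤
        2 * ((ux₁ t y - ux₂ t y) * (ux₁ t y - ux₂ t y) + w t y * (uxx₁ t y - uxx₂ t y)) +
        ((2 * L * (1 + M) + M ^ α) * w t y ^ 2 + M ^ α * d ^ 2) := by
      intro y hy
      have B1 := b1 t htT y hy
      have B2 := b2 t htT y hy
      have lip := rpow_lip hα1 B1 B2
      have hp0 : 0 ≤ u₂ t y ^ α := Real.rpow_nonneg B2.1 _
      have hp1 : u₂ t y ^ α ≤ M ^ α := Real.rpow_le_rpow B2.1 B2.2 (by linarith)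
      rw [eq1 t ht0 y hy, eq2 t ht0 y hy]
      have hwy : u₁ t y - u₂ t y = w t y := rfl
      rw [hwy, ← hL] at lip
      have e : 2 * w t y * (uxx₁ t y + u₁ t y ^ α * (1 - m₁) - (uxx₂ t y + u₂ t y ^ α * (1 - m₂))) =
          2 * (w t y * (uxx₁ t y - uxx₂ t y)) +
          2 * (w t y * ((u₁ t y ^ α - u₂ t y ^ α) * (1 - m₁))) -
          u₂ t y ^ α * (2 * (w t y * d)) := by rw [hd]; ring
      rw [e]
      have i1 : w t y * ((u₁ t y ^ α - u₂ t y ^ α) * (1 - m₁)) ≤ L * (1 + M) * w t y ^ 2 := by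
        refine (le_abs_self _).trans ?_
        rw [abs_mul, abs_mul]
        have h3 : |1 - m₁| ≤ 1 + M := by rw [abs_le]; constructor <;> linarith [m1M.1, m1M.2]
        calc |w t y| * (|u₁ t y ^ α - u₂ t y ^ α| * |1 - m₁|)
            ≤ |w t y| * ((L * |w t y|) * (1 + M)) := by gcongr
          _ = L * (1 + M) * |w t y| ^ 2 := by ring
          _ = _ := by rw [sq_abs]
      have i2 : -(u₂ t y ^ α * (2 * (w t y * d))) ≤ M ^ α * (w t y ^ 2 + d ^ 2) := by
        have h4 : -(2 * (w t y * d)) ≤ w t y ^ 2 + d ^ 2 := by nlinarith [sq_nonneg (w t y + d)]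
        have h5 : 0 ≤ w t y ^ 2 + d ^ 2 := by positivity
        calc -(u₂ t y ^ α * (2 * (w t y * d))) = u₂ t y ^ α * (-(2 * (w t y * d))) := by ring
          _ ≤ u₂ t y ^ α * (w t y ^ 2 + d ^ 2) := mul_le_mul_of_nonneg_left h4 hp0
          _ ≤ _ := mul_le_mul_of_nonneg_right hp1 h5
      nlinarith [mul_self_nonneg (ux₁ t y - ux₂ t y)]
    have iP : IntervalIntegrable (fun y => (ux₁ t y - ux₂ t y) * (ux₁ t y - ux₂ t y) +
        w t y * (uxx₁ t y - uxx₂ t y)) volume 0 1 := ii ((swx.mul swx).add (sw.mul swxx))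
    have h6 := intervalIntegral.integral_mono_on zero_le_one
      (ii ((continuousOn_const.mul sw).mul swt))
      ((iP.const_mul 2).add ((iw2.const_mul _).add intervalIntegrable_const)) pt
    rw [intervalIntegral.integral_add (iP.const_mul 2)
      ((iw2.const_mul _).add intervalIntegrable_const), intervalIntegral.integral_const_mul, parts,
      intervalIntegral.integral_add (iw2.const_mul _) intervalIntegrable_const,
      intervalIntegral.integral_const_mul] at h6
    simp only [intervalIntegral.integral_const, sub_zero, smul_eq_mul, one_mul] at h6
    refine h6.trans ?_
    change 2 * 0 + ((2 * L * (1 + M) + M ^ α) * En t + M ^ α * d ^ 2) ≤ c * En t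
    rw [hcdef]
    nlinarith [mul_le_mul_of_nonneg_left d2 hMa]
  -- Gronwall
  have anti : AntitoneOn (fun t => rexp (-(c * t)) * En t) (Icc 0 T) := by
    have hder : ∀ t, 0 < t → HasDerivAt (fun t => rexp (-(c * t)) * En t)
        (rexp (-(c * t)) * (-(c * 1)) * En t + rexp (-(c * t)) *
          ∫ x in (0:ℝ)..1, 2 * w t x * (ut₁ t x - ut₂ t x)) t := fun t ht =>
      ((((hasDerivAt_id t).const_mul c).neg).exp).mul (dE t ht)
    refine antitoneOn_of_deriv_nonpos (convex_Icc 0 T) ?_ ?_ ?_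
    · exact (by fun_prop : Continuous fun t => rexp (-(c * t))).continuousOn.mul
        (cE.mono fun t ht => ht.1)
    · intro t ht
      rw [interior_Icc] at ht
      exact (hder t ht.1).differentiableAt.differentiableWithinAt
    · intro t ht
      rw [interior_Icc] at ht
      rw [(hder t ht.1).deriv]
      nlinarith [key t ht, Real.exp_pos (-(c * t))]
  have hET := anti ⟨le_rfl, hT⟩ ⟨hT, le_rfl⟩ hT
  simp only [E0, mul_zero] at hET
  have hE : En T ≤ 0 := by
    by_contra hlt
    have := mul_pos (Real.exp_pos (-(c * T))) (not_le.1 hlt)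
    linarith
  by_contra hne
  have hpos : 0 < En T := intervalIntegral.integral_pos zero_lt_one
    ((slice wc (show T ∈ Ici (0:ℝ) from hT)).pow 2) (fun y _ => sq_nonneg _)
    ⟨x, hx, by have : w T x ≠ 0 := sub_ne_zero.2 hne
               positivity⟩
  linarith

end KPP

/-- **Global well-posedness, subcritical mass (`n = 1`).**  For `1 ≤ α < 2` and a
continuous nonnegative initial datum `u₀` on `[0,1]` with `0 < ∫₀¹ u₀ < 1`, the 1-D
nonlocal Fisher–KPP problem has a nonnegative classical solution with datum `u₀`, and
any two nonnegative classical solutions with datum `u₀` coincide on `[0,∞) × [0,1]`. -/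
theorem global_wellposedness_subcritical (α : ℝ) (hα1 : 1 ≤ α) (hα2 : α < 2)
    (u₀ : ℝ → ℝ) (hu₀_cont : ContinuousOn u₀ (Icc 0 1))
    (hu₀_nonneg : ∀ x ∈ Icc (0:ℝ) 1, 0 ≤ u₀ x)
    (hm₀_pos : 0 < ∫ x in (0:ℝ)..1, u₀ x)
    (hm₀_lt : (∫ x in (0:ℝ)..1, u₀ x) < 1) :
    (∃ u ut ux uxx : ℝ → ℝ → ℝ, IsKPPSolution α u ut ux uxx ∧ KPPNonneg u ∧
        ∀ x ∈ Icc (0:ℝ) 1, u 0 x = u₀ x) ∧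
      ∀ u₁ ut₁ ux₁ uxx₁ u₂ ut₂ ux₂ uxx₂ : ℝ → ℝ → ℝ,
        IsKPPSolution α u₁ ut₁ ux₁ uxx₁ → KPPNonneg u₁ →
        (∀ x ∈ Icc (0:ℝ) 1, u₁ 0 x = u₀ x) →
        IsKPPSolution α u₂ ut₂ ux₂ uxx₂ → KPPNonneg u₂ →
        (∀ x ∈ Icc (0:ℝ) 1, u₂ 0 x = u₀ x) →
        ∀ t ∈ Ici (0:ℝ), ∀ x ∈ Icc (0:ℝ) 1, u₁ t x = u₂ t x := by
  refine ⟨KPP.existence hα1 hα2 hu₀_cont hu₀_nonneg hm₀_lt, ?_⟩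
  intro u₁ ut₁ ux₁ uxx₁ u₂ ut₂ ux₂ uxx₂ H1 N1 I1 H2 N2 I2 t ht x hx
  exact KPP.uniqueness hα1 H1 N1 H2 N2 (fun y hy => (I1 y hy).trans (I2 y hy).symm) ht hx
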